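/- arXiv:2004.10923 — 8 statements merged into one kernel-verified Lean document; each statement's English description precedes it below -/
import Mathlib

section
/- Let (X,d) be a finite metric space X = {x_0, x_1, ..., x_n} with maximal generalised roundness ℘ = mgr(X) < ∞. Then ℘ = min{p > 0 : det(M_p) = 0}, where M_p is the Cayley–Menger matrix of X at exponent p. In particular, det(M_p) ≠ 0 for all 0 < p < ℘ and det(M_℘) = 0. -/
open Matrix BigOperators

/-- A metric space `(X, d)` has `p`-negative type: for all finite collections of points
`x_1, …, x_N` and reals `ξ_1, …, ξ_N` summing to `0`,
`∑_{i,j} d(x_i, x_j)^p ξ_i ξ_j ≤ 0`. -/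
def IsNegType (X : Type*) [MetricSpace X] (p : ℝ) : Prop :=
  ∀ (N : ℕ) (x : Fin N → X) (ξ : Fin N → ℝ), (∑ i, ξ i) = 0 →
    ∑ i, ∑ j, dist (x i) (x j) ^ p * ξ i * ξ j ≤ 0

/-- The maximal generalised roundness (supremal `p`-negative type) of a metric space. -/
noncomputable def mgr (X : Type*) [MetricSpace X] : ℝ :=
  sSup {p : ℝ | 0 ≤ p ∧ IsNegType X p}

/-- The `p`-distance matrix `D_p = (d(x_i, x_j)^p)` of the finite metric space
`X = {x_0, …, x_n}` (modelled as a metric on `Fin (n+1)`). -/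
noncomputable def Dmat (n : ℕ) [MetricSpace (Fin (n + 1))] (p : ℝ) :
    Matrix (Fin (n + 1)) (Fin (n + 1)) ℝ :=
  Matrix.of fun i j => dist i j ^ p

/-- The Cayley–Menger matrix `M_p = [[0, 𝟙ᵀ], [𝟙, D_p]]`. -/
noncomputable def CM (n : ℕ) [MetricSpace (Fin (n + 1))] (p : ℝ) :
    Matrix (Fin 1 ⊕ Fin (n + 1)) (Fin 1 ⊕ Fin (n + 1)) ℝ :=
  Matrix.fromBlocks 0 (Matrix.of fun _ _ => 1) (Matrix.of fun _ _ => 1) (Dmat n p)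

open Filter Topology Set MeasureTheory

section QuadraticForm

variable {ι : Type*} [Fintype ι]

/-- The quadratic form `∑_{i,j} K i j ξ i ξ j` of a kernel `K` on a finite type. -/
def kernelForm (K : ι → ι → ℝ) (ξ : ι → ℝ) : ℝ :=
  ∑ i, ∑ j, K i j * ξ i * ξ j

/-- A kernel is conditionally negative if its quadratic form is nonpositive on vectors with
coordinate sum zero. -/
def IsCondNeg (K : ι → ι → ℝ) : Prop :=
  ∀ ξ : ι → ℝ, ∑ i, ξ i = 0 → kernelForm K ξ ≤ 0

/-- A kernel is strictly conditionally negative if its quadratic form is negative on nonzero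
vectors with coordinate sum zero. -/
def IsStrictCondNeg (K : ι → ι → ℝ) : Prop :=
  ∀ ξ : ι → ℝ, ∑ i, ξ i = 0 → ξ ≠ 0 → kernelForm K ξ < 0

theorem kernelForm_eq_sum_mul (K : ι → ι → ℝ) (ξ : ι → ℝ) :
    kernelForm K ξ = ∑ i, ξ i * ∑ j, K i j * ξ j := by
  simp only [kernelForm, Finset.mul_sum]
  exact Finset.sum_congr rfl fun i _ => Finset.sum_congr rfl fun j _ => by ring

theorem kernelForm_smul (K : ι → ι → ℝ) (c : ℝ) (ξ : ι → ℝ) :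
    kernelForm K (c • ξ) = c ^ 2 * kernelForm K ξ := by
  simp only [kernelForm, Finset.mul_sum, Pi.smul_apply, smul_eq_mul]
  exact Finset.sum_congr rfl fun i _ => Finset.sum_congr rfl fun j _ => by ring

theorem kernelForm_add_smul {K : ι → ι → ℝ} (hK : ∀ i j, K i j = K j i) (ξ η : ι → ℝ) (t : ℝ) :
    kernelForm K (ξ + t • η) =
      kernelForm K ξ + 2 * t * (∑ i, η i * ∑ j, K i j * ξ j) + t ^ 2 * kernelForm K η := by
  have hswap : ∑ i, ∑ j, K i j * ξ i * η j = ∑ i, η i * ∑ j, K i j * ξ j := by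
    rw [Finset.sum_comm]
    simp only [Finset.mul_sum]
    exact Finset.sum_congr rfl fun i _ => Finset.sum_congr rfl fun j _ => by rw [hK j i]; ring
  have hself : ∑ i, ∑ j, K i j * η i * ξ j = ∑ i, η i * ∑ j, K i j * ξ j := by
    simp only [Finset.mul_sum]
    exact Finset.sum_congr rfl fun i _ => Finset.sum_congr rfl fun j _ => by ring
  calc kernelForm K (ξ + t • η)
      = kernelForm K ξ + t * (∑ i, ∑ j, K i j * ξ i * η j) + t * (∑ i, ∑ j, K i j * η i * ξ j)
          + t ^ 2 * kernelForm K η := by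
        simp only [kernelForm, Finset.mul_sum, ← Finset.sum_add_distrib]
        refine Finset.sum_congr rfl fun i _ => Finset.sum_congr rfl fun j _ => ?_
        simp only [Pi.add_apply, Pi.smul_apply, smul_eq_mul]
        ring
    _ = _ := by rw [hswap, hself]; ring

theorem kernelForm_nonneg_of_posSemidef {A : Matrix ι ι ℝ} (hA : A.PosSemidef) (ξ : ι → ℝ) :
    0 ≤ kernelForm (fun i j => A i j) ξ := by
  have h := (Matrix.posSemidef_iff_dotProduct_mulVec.1 hA).2 ξ
  rw [kernelForm_eq_sum_mul]
  simpa [dotProduct, Matrix.mulVec] using h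

theorem posSemidef_of_kernelForm_nonneg {A : Matrix ι ι ℝ} (hA : ∀ i j, A i j = A j i)
    (h : ∀ ξ, 0 ≤ kernelForm (fun i j => A i j) ξ) : A.PosSemidef := by
  refine Matrix.posSemidef_iff_dotProduct_mulVec.2 ⟨?_, fun ξ => ?_⟩
  · ext i j
    simp [hA i j]
  · have hξ := h ξ
    rw [kernelForm_eq_sum_mul] at hξ
    simpa [dotProduct, Matrix.mulVec] using hξ

theorem Matrix.PosSemidef.map_pow {A : Matrix ι ι ℝ} (hA : A.PosSemidef) (k : ℕ) :
    (A.map (· ^ k)).PosSemidef := by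
  induction k with
  | zero =>
    refine posSemidef_of_kernelForm_nonneg (fun _ _ => by simp) fun ξ => ?_
    have h : kernelForm (fun i j => A.map (· ^ 0) i j) ξ = (∑ i, ξ i) ^ 2 := by
      simp [kernelForm, sq, Finset.sum_mul_sum]
    rw [h]
    positivity
  | succ k ih =>
    have h : A.map (· ^ (k + 1)) = Matrix.hadamard (A.map (· ^ k)) A := by
      ext i j
      simp [pow_succ]
    rw [h]
    exact ih.hadamard hA

theorem kernelForm_exp_nonneg {A : Matrix ι ι ℝ} (hA : A.PosSemidef) (ξ : ι → ℝ) :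
    0 ≤ kernelForm (fun i j => Real.exp (A i j)) ξ := by
  have hsum : HasSum (fun k : ℕ => ∑ i, ∑ j, A i j ^ k / (k.factorial : ℝ) * ξ i * ξ j)
      (kernelForm (fun i j => Real.exp (A i j)) ξ) := by
    refine hasSum_sum fun i _ => hasSum_sum fun j _ => ?_
    refine HasSum.mul_right _ (HasSum.mul_right _ ?_)
    rw [Real.exp_eq_exp_ℝ]
    exact NormedSpace.expSeries_div_hasSum_exp (A i j)
  refine hsum.nonneg fun k => ?_
  have h : ∑ i, ∑ j, A i j ^ k / (k.factorial : ℝ) * ξ i * ξ j =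
      (k.factorial : ℝ)⁻¹ * kernelForm (fun i j => A.map (· ^ k) i j) ξ := by
    simp only [kernelForm, Finset.mul_sum, Matrix.map_apply]
    exact Finset.sum_congr rfl fun i _ => Finset.sum_congr rfl fun j _ => by ring
  rw [h]
  exact mul_nonneg (by positivity) (kernelForm_nonneg_of_posSemidef (hA.map_pow k) ξ)

theorem IsCondNeg.posSemidef_centered {K : ι → ι → ℝ} (hK : IsCondNeg K)
    (hsymm : ∀ i j, K i j = K j i) (o : ι) :
    (Matrix.of fun i j => K i o + K j o - K i j - K o o).PosSemidef := by
  classical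
  refine posSemidef_of_kernelForm_nonneg (fun i j => ?_) fun ξ => ?_
  · simp only [Matrix.of_apply, hsymm i j]
    ring
  · set s := ∑ i, ξ i with hs
    have hη : ∑ i, (ξ + (-s) • (Pi.single o 1 : ι → ℝ)) i = 0 := by
      simp [Finset.sum_add_distrib, ← hs, Pi.single_apply]
    have h := hK _ hη
    rw [kernelForm_add_smul hsymm] at h
    have h1 : ∑ i, (Pi.single o (1 : ℝ) : ι → ℝ) i * ∑ j, K i j * ξ j = ∑ j, K j o * ξ j := by
      simp [Pi.single_apply, hsymm o]
    have h2 : kernelForm K (Pi.single o (1 : ℝ)) = K o o := by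
      simp [kernelForm, Pi.single_apply]
    rw [h1, h2] at h
    have h3 : kernelForm (fun i j => K i o + K j o - K i j - K o o) ξ =
        2 * s * (∑ j, K j o * ξ j) - kernelForm K ξ - s ^ 2 * K o o := by
      have ha : ∑ i, ∑ j, K i o * ξ i * ξ j = s * ∑ j, K j o * ξ j := by
        rw [mul_comm, hs, Finset.sum_mul_sum]
      have hb : ∑ i, ∑ j, K j o * ξ i * ξ j = s * ∑ j, K j o * ξ j := by
        rw [hs, Finset.sum_mul_sum]
        exact Finset.sum_congr rfl fun i _ => Finset.sum_congr rfl fun j _ => by ring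
      have hc : ∑ i, ∑ j, K o o * ξ i * ξ j = s ^ 2 * K o o := by
        rw [sq, hs, Finset.sum_mul_sum, Finset.sum_mul]
        refine Finset.sum_congr rfl fun i _ => ?_
        rw [Finset.sum_mul]
        exact Finset.sum_congr rfl fun j _ => by ring
      simp only [kernelForm, sub_mul, add_mul, Finset.sum_sub_distrib,
        Finset.sum_add_distrib, ha, hb, hc]
      ring
    simp only [Matrix.of_apply, h3]
    linarith

/-- **Schoenberg's theorem**: `exp (-K)` is positive semidefinite if `K` is conditionally
negative. -/
theorem IsCondNeg.kernelForm_exp_neg_nonneg {K : ι → ι → ℝ} (hK : IsCondNeg K)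
    (hsymm : ∀ i j, K i j = K j i) (ξ : ι → ℝ) :
    0 ≤ kernelForm (fun i j => Real.exp (-K i j)) ξ := by
  rcases isEmpty_or_nonempty ι with _ | ⟨⟨o⟩⟩
  · simp [kernelForm]
  · have h := kernelForm_exp_nonneg (hK.posSemidef_centered hsymm o)
      fun i => Real.exp (-K i o + K o o / 2) * ξ i
    convert h using 1
    refine Finset.sum_congr rfl fun i _ => Finset.sum_congr rfl fun j _ => ?_
    have he : Real.exp (-K i j) = Real.exp (K i o + K j o - K i j - K o o) *
        Real.exp (-K i o + K o o / 2) * Real.exp (-K j o + K o o / 2) := by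
      rw [← Real.exp_add, ← Real.exp_add]
      ring_nf
    simp only [he, Matrix.of_apply]
    ring

theorem IsStrictCondNeg.eventually_isCondNeg {X : Type*} [TopologicalSpace X]
    {E : X → ι → ι → ℝ} {p₀ : X} (hE : ∀ i j, Continuous fun p => E p i j)
    (h : IsStrictCondNeg (E p₀)) : ∀ᶠ p in 𝓝 p₀, IsCondNeg (E p) := by
  have hcont : Continuous fun z : X × (ι → ℝ) => kernelForm (E z.1) z.2 := by
    unfold kernelForm
    refine continuous_finsetSum _ fun i _ => continuous_finsetSum _ fun j _ => ?_
    have := (hE i j).comp (continuous_fst (X := X) (Y := ι → ℝ))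
    simp only [Function.comp_def] at this
    fun_prop
  have hS : IsCompact (Metric.sphere (0 : ι → ℝ) 1 ∩ {ξ | ∑ i, ξ i = 0}) :=
    (isCompact_sphere 0 1).inter_right (isClosed_eq (by fun_prop) continuous_const)
  have hev : ∀ᶠ p in 𝓝 p₀, ∀ ξ ∈ Metric.sphere (0 : ι → ℝ) 1 ∩ {ξ | ∑ i, ξ i = 0},
      kernelForm (E p) ξ < 0 := by
    refine hS.eventually_forall_of_forall_eventually fun ξ hξ => ?_
    refine hcont.continuousAt.eventually_lt continuousAt_const (h ξ hξ.2 ?_)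
    rintro rfl
    simpa using hξ.1
  filter_upwards [hev] with p hp ξ hξ
  by_cases h0 : ξ = 0
  · simp [h0, kernelForm]
  · have hn : 0 < ‖ξ‖ := norm_pos_iff.2 h0
    have h1 := hp (‖ξ‖⁻¹ • ξ) ⟨by simp [norm_smul, hn.ne'], by simp [← Finset.mul_sum, hξ]⟩
    rw [kernelForm_smul] at h1
    exact (neg_of_mul_neg_right h1 (by positivity)).le

/-- An isotropic vector of a conditionally negative form is mapped to a constant vector. -/
theorem IsCondNeg.sum_mul_eq_of_kernelForm_eq_zero {K : ι → ι → ℝ} (hK : IsCondNeg K)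
    (hsymm : ∀ i j, K i j = K j i) {ξ : ι → ℝ} (hξ : ∑ i, ξ i = 0) (h : kernelForm K ξ = 0)
    (a b : ι) : ∑ j, K a j * ξ j = ∑ j, K b j * ξ j := by
  classical
  set η : ι → ℝ := Pi.single a 1 - Pi.single b 1 with hη
  have hη0 : ∑ i, η i = 0 := by simp [hη]
  have hB : ∑ i, η i * ∑ j, K i j * ξ j = ∑ j, K a j * ξ j - ∑ j, K b j * ξ j := by
    simp [hη, sub_mul, Finset.sum_sub_distrib, Pi.single_apply]
  have hd := discrim_le_zero (a := -kernelForm K η)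
    (b := -(2 * ∑ i, η i * ∑ j, K i j * ξ j)) (c := 0) fun t => by
      have h1 := hK (ξ + t • η) (by simp [Finset.sum_add_distrib, ← Finset.mul_sum, hξ, hη0])
      rw [kernelForm_add_smul hsymm, h] at h1
      linarith
  rw [discrim, hB] at hd
  have h0 : (∑ j, K a j * ξ j - ∑ j, K b j * ξ j) ^ 2 = 0 :=
    le_antisymm (by linarith) (sq_nonneg _)
  exact sub_eq_zero.1 (pow_eq_zero_iff two_ne_zero |>.1 h0)

end QuadraticForm

section FractionalPower

theorem integrableOn_one_sub_exp_neg_mul_rpow {α : ℝ} (h0 : 0 < α) (h1 : α < 1) :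
    IntegrableOn (fun t : ℝ => (1 - Real.exp (-t)) * t ^ (-1 - α)) (Ioi 0) := by
  have hcont : ContinuousOn (fun t : ℝ => (1 - Real.exp (-t)) * t ^ (-1 - α)) (Ioi 0) :=
    ContinuousOn.mul (by fun_prop) fun t ht =>
      (Real.continuousAt_rpow_const _ _ (Or.inl (ne_of_gt ht))).continuousWithinAt
  rw [← Ioc_union_Ioi_eq_Ioi zero_le_one]
  refine IntegrableOn.union ?_ ?_
  · have hInt : IntegrableOn (fun t : ℝ => t ^ (-α)) (Ioc 0 1) :=
      (intervalIntegrable_iff_integrableOn_Ioc_of_le zero_le_one).1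
        (intervalIntegral.intervalIntegrable_rpow' (by linarith))
    refine hInt.mono' ((hcont.mono Ioc_subset_Ioi_self).aestronglyMeasurable measurableSet_Ioc) ?_
    filter_upwards [ae_restrict_mem measurableSet_Ioc] with t ht
    have ht0 : 0 < t := ht.1
    have he : Real.exp (-t) ≤ 1 := Real.exp_le_one_iff.2 (by linarith)
    rw [Real.norm_of_nonneg (mul_nonneg (by linarith) (by positivity))]
    calc (1 - Real.exp (-t)) * t ^ (-1 - α) ≤ t * t ^ (-1 - α) := by
          gcongr
          linarith [Real.add_one_le_exp (-t)]
      _ = t ^ (-α) := by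
          rw [← Real.rpow_one_add' ht0.le (by linarith)]
          ring_nf
  · have hInt : IntegrableOn (fun t : ℝ => t ^ (-1 - α)) (Ioi 1) :=
      integrableOn_Ioi_rpow_of_lt (by linarith) one_pos
    refine hInt.mono'
      ((hcont.mono (Ioi_subset_Ioi zero_le_one)).aestronglyMeasurable measurableSet_Ioi) ?_
    filter_upwards [ae_restrict_mem measurableSet_Ioi] with t ht
    have ht0 : 0 < t := one_pos.trans ht
    have he : Real.exp (-t) ≤ 1 := Real.exp_le_one_iff.2 (by linarith)
    rw [Real.norm_of_nonneg (mul_nonneg (by linarith) (by positivity))]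
    exact mul_le_of_le_one_left (by positivity) (by linarith [Real.exp_pos (-t)])

theorem one_sub_exp_neg_mul_eq {x t : ℝ} (hx : 0 < x) (ht : 0 < t) (α : ℝ) :
    (1 - Real.exp (-(t * x))) * t ^ (-1 - α) =
      x ^ (1 + α) * ((1 - Real.exp (-(x * t))) * (x * t) ^ (-1 - α)) := by
  have h : x ^ (1 + α) * x ^ (-1 - α) = 1 := by
    rw [← Real.rpow_add hx]
    simp
  rw [Real.mul_rpow hx.le ht.le, mul_comm t x]
  linear_combination (-(1 - Real.exp (-(x * t))) * t ^ (-1 - α)) * h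

theorem integrableOn_one_sub_exp_neg_mul_mul_rpow {α x : ℝ} (h0 : 0 < α) (h1 : α < 1)
    (hx : 0 ≤ x) :
    IntegrableOn (fun t : ℝ => (1 - Real.exp (-(t * x))) * t ^ (-1 - α)) (Ioi 0) := by
  rcases hx.eq_or_lt with rfl | hx
  · simp
  · have h := (integrableOn_Ioi_comp_mul_left_iff
      (fun t : ℝ => (1 - Real.exp (-t)) * t ^ (-1 - α)) 0 hx).2
        (by simpa using integrableOn_one_sub_exp_neg_mul_rpow h0 h1)
    exact IntegrableOn.congr_fun (h.const_mul (x ^ (1 + α)))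
      (fun t ht => (one_sub_exp_neg_mul_eq hx ht α).symm) measurableSet_Ioi

theorem integral_one_sub_exp_neg_mul_mul_rpow {α x : ℝ} (h0 : 0 < α) (hx : 0 ≤ x) :
    ∫ t in Ioi (0 : ℝ), (1 - Real.exp (-(t * x))) * t ^ (-1 - α) =
      x ^ α * ∫ t in Ioi (0 : ℝ), (1 - Real.exp (-t)) * t ^ (-1 - α) := by
  rcases hx.eq_or_lt with rfl | hx
  · simp [Real.zero_rpow h0.ne']
  · rw [setIntegral_congr_fun measurableSet_Ioi fun t ht => one_sub_exp_neg_mul_eq hx ht α,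
      integral_const_mul,
      integral_comp_mul_left_Ioi (fun t : ℝ => (1 - Real.exp (-t)) * t ^ (-1 - α)) 0 hx,
      mul_zero, smul_eq_mul, ← mul_assoc, Real.rpow_add hx, Real.rpow_one]
    field_simp

variable {ι : Type*} [Fintype ι]

theorem tendsto_kernelForm_exp_neg {K : ι → ι → ℝ} (hdiag : ∀ i, K i i = 0)
    (hpos : ∀ i j, i ≠ j → 0 < K i j) (ξ : ι → ℝ) :
    Tendsto (fun t : ℝ => kernelForm (fun i j => Real.exp (-(t * K i j))) ξ) atTop
      (𝓝 (∑ i, ξ i ^ 2)) := by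
  classical
  have h : ∑ i, ξ i ^ 2 = ∑ i, ∑ j, (if i = j then 1 else 0) * ξ i * ξ j := by
    simp [sq]
  rw [h]
  refine tendsto_finsetSum _ fun i _ => tendsto_finsetSum _ fun j _ => ?_
  refine Tendsto.mul_const _ (Tendsto.mul_const _ ?_)
  split_ifs with hij
  · subst hij
    simp [hdiag]
  · exact Real.tendsto_exp_neg_atTop_nhds_zero.comp (tendsto_id.atTop_mul_const (hpos i j hij))

/-- Fractional powers of a conditionally negative kernel are strictly conditionally negative. -/
theorem IsCondNeg.isStrictCondNeg_rpow {K : ι → ι → ℝ} (hK : IsCondNeg K)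
    (hsymm : ∀ i j, K i j = K j i) (hdiag : ∀ i, K i i = 0) (hpos : ∀ i j, i ≠ j → 0 < K i j)
    {α : ℝ} (h0 : 0 < α) (h1 : α < 1) : IsStrictCondNeg fun i j => K i j ^ α := by
  intro ξ hξ hne
  have hnonneg : ∀ i j, 0 ≤ K i j := fun i j => by
    rcases eq_or_ne i j with rfl | hij
    · exact (hdiag i).ge
    · exact (hpos i j hij).le
  set C := ∫ t in Ioi (0 : ℝ), (1 - Real.exp (-t)) * t ^ (-1 - α)
  have hC : 0 ≤ C := setIntegral_nonneg measurableSet_Ioi fun t ht =>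
    mul_nonneg (sub_nonneg.2 (Real.exp_le_one_iff.2 (neg_nonpos.2 (le_of_lt ht))))
      (Real.rpow_nonneg (le_of_lt ht) _)
  set F : ℝ → ℝ := fun t => kernelForm (fun i j => Real.exp (-(t * K i j))) ξ * t ^ (-1 - α)
  have hF : ∀ t, F t = -∑ i, ∑ j, (1 - Real.exp (-(t * K i j))) * t ^ (-1 - α) * (ξ i * ξ j) := by
    intro t
    have hone : ∑ i, ∑ j, ξ i * ξ j = 0 := by rw [← Finset.sum_mul_sum, hξ, zero_mul]
    have hs : ∑ i, ∑ j, (1 - Real.exp (-(t * K i j))) * t ^ (-1 - α) * (ξ i * ξ j) =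
        t ^ (-1 - α) * (∑ i, ∑ j, ξ i * ξ j) - F t := by
      simp only [F, kernelForm, Finset.mul_sum, Finset.sum_mul, ← Finset.sum_sub_distrib]
      exact Finset.sum_congr rfl fun i _ => Finset.sum_congr rfl fun j _ => by ring
    rw [hs, hone]
    ring
  have hInt : ∀ i j, IntegrableOn
      (fun t : ℝ => (1 - Real.exp (-(t * K i j))) * t ^ (-1 - α) * (ξ i * ξ j)) (Ioi 0) :=
    fun i j => (integrableOn_one_sub_exp_neg_mul_mul_rpow h0 h1 (hnonneg i j)).mul_const _
  have hFint : IntegrableOn F (Ioi 0) := by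
    rw [funext hF]
    exact (integrable_finsetSum _ fun i _ => integrable_finsetSum _ fun j _ => hInt i j).neg
  have hFval : ∫ t in Ioi (0 : ℝ), F t = -(C * kernelForm (fun i j => K i j ^ α) ξ) := by
    rw [funext hF, integral_neg, integral_finsetSum _ fun i _ =>
      integrable_finsetSum _ fun j _ => hInt i j]
    simp only [kernelForm, Finset.mul_sum]
    congr 1
    refine Finset.sum_congr rfl fun i _ => ?_
    rw [integral_finsetSum _ fun j _ => hInt i j]
    refine Finset.sum_congr rfl fun j _ => ?_
    rw [integral_mul_const, integral_one_sub_exp_neg_mul_mul_rpow h0 (hnonneg i j)]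
    ring
  have hform : ∀ t : ℝ, 0 < t → 0 ≤ kernelForm (fun i j => Real.exp (-(t * K i j))) ξ := by
    intro t ht
    refine IsCondNeg.kernelForm_exp_neg_nonneg (K := fun i j => t * K i j) (fun η hη => ?_)
      (fun i j => by rw [hsymm]) ξ
    have h : kernelForm (fun i j => t * K i j) η = t * kernelForm K η := by
      simp only [kernelForm, Finset.mul_sum, mul_assoc]
    rw [h]
    exact mul_nonpos_of_nonneg_of_nonpos ht.le (hK η hη)
  have hsq : 0 < ∑ i, ξ i ^ 2 := by
    obtain ⟨i, hi⟩ := Function.ne_iff.1 hne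
    exact Finset.sum_pos' (fun i _ => sq_nonneg _) ⟨i, Finset.mem_univ i, sq_pos_of_ne_zero hi⟩
  have hFpos : 0 < ∫ t in Ioi (0 : ℝ), F t := by
    rw [setIntegral_pos_iff_support_of_nonneg_ae ?_ hFint]
    · obtain ⟨T, hT⟩ := eventually_atTop.1
        ((tendsto_kernelForm_exp_neg hdiag hpos ξ).eventually_const_lt hsq)
      refine lt_of_lt_of_le ?_ (measure_mono (s := Ioi (max T 0)) fun t ht => ?_)
      · simp
      · have ht0 : 0 < t := (le_max_right _ _).trans_lt ht
        exact ⟨(mul_pos (hT t ((le_max_left _ _).trans (le_of_lt ht)))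
          (Real.rpow_pos_of_pos ht0 _)).ne', ht0⟩
    · filter_upwards [ae_restrict_mem measurableSet_Ioi] with t ht
      exact mul_nonneg (hform t ht) (Real.rpow_nonneg (le_of_lt ht) _)
  rw [hFval] at hFpos
  exact neg_of_mul_neg_right (neg_pos.1 hFpos) hC

end FractionalPower

theorem isNegType_iff_isCondNeg {n : ℕ} [MetricSpace (Fin (n + 1))] {p : ℝ} :
    IsNegType (Fin (n + 1)) p ↔ IsCondNeg fun i j : Fin (n + 1) => dist i j ^ p := by
  refine ⟨fun h ξ hξ => h (n + 1) id ξ hξ, fun h N x ξ hξ => ?_⟩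
  have hsum : ∑ a, ∑ i, (if x i = a then ξ i else 0) = 0 := by
    rw [Finset.sum_comm]
    simpa using hξ
  have key := h (fun a => ∑ i, if x i = a then ξ i else 0) hsum
  have heq : kernelForm (fun i j : Fin (n + 1) => dist i j ^ p)
      (fun a => ∑ i, if x i = a then ξ i else 0) =
        ∑ i, ∑ j, dist (x i) (x j) ^ p * ξ i * ξ j := by
    have hpush : ∀ f : Fin (n + 1) → ℝ,
        ∑ a, (∑ i, if x i = a then ξ i else 0) * f a = ∑ i, ξ i * f (x i) := by
      intro f
      simp only [Finset.sum_mul, ite_mul, zero_mul]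
      rw [Finset.sum_comm]
      simp
    rw [kernelForm_eq_sum_mul, hpush]
    refine Finset.sum_congr rfl fun i _ => ?_
    simp only [mul_comm (dist _ _ ^ p)]
    rw [hpush, Finset.mul_sum]
    exact Finset.sum_congr rfl fun j _ => by ring
  rwa [heq] at key

/-- The `p`-distance kernel with vanishing diagonal, which unlike `dist i j ^ p` is continuous
in `p` at `0`. -/
noncomputable def offDiagDist (X : Type*) [MetricSpace X] [DecidableEq X] (p : ℝ) (i j : X) : ℝ :=
  if i = j then 0 else dist i j ^ p

theorem offDiagDist_eq {X : Type*} [MetricSpace X] [DecidableEq X] {p : ℝ} (hp : p ≠ 0) :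
    offDiagDist X p = fun i j => dist i j ^ p := by
  ext i j
  rcases eq_or_ne i j with rfl | hij
  · simp [offDiagDist, Real.zero_rpow hp]
  · simp [offDiagDist, hij]

theorem continuous_offDiagDist {X : Type*} [MetricSpace X] [DecidableEq X] (i j : X) :
    Continuous fun p => offDiagDist X p i j := by
  rcases eq_or_ne i j with rfl | hij
  · simpa [offDiagDist] using continuous_const
  · simpa [offDiagDist, hij] using
      Real.continuous_const_rpow (dist_pos.2 hij).ne'

theorem isStrictCondNeg_offDiagDist_zero {X : Type*} [MetricSpace X] [DecidableEq X] [Fintype X] :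
    IsStrictCondNeg (offDiagDist X 0) := by
  intro ξ hξ hne
  have h : kernelForm (offDiagDist X 0) ξ = (∑ i, ξ i) * (∑ i, ξ i) - ∑ i, ξ i ^ 2 := by
    have h1 : ∑ i, ξ i ^ 2 = ∑ i, ∑ j, (if i = j then 1 else 0) * ξ i * ξ j := by
      simp [sq]
    rw [h1, Finset.sum_mul_sum]
    simp only [kernelForm, ← Finset.sum_sub_distrib]
    refine Finset.sum_congr rfl fun i _ => Finset.sum_congr rfl fun j _ => ?_
    unfold offDiagDist
    split_ifs <;> simp
  rw [h, hξ]
  obtain ⟨i, hi⟩ := Function.ne_iff.1 hne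
  have hsq : 0 < ∑ i, ξ i ^ 2 :=
    Finset.sum_pos' (fun i _ => sq_nonneg _) ⟨i, Finset.mem_univ i, sq_pos_of_ne_zero hi⟩
  linarith

theorem CM_mulVec_eq_zero_iff {n : ℕ} [MetricSpace (Fin (n + 1))] {p : ℝ}
    {v : Fin 1 ⊕ Fin (n + 1) → ℝ} :
    CM n p *ᵥ v = 0 ↔ ∑ i, v (Sum.inr i) = 0 ∧
      ∀ i, v (Sum.inl 0) + ∑ j, dist i j ^ p * v (Sum.inr j) = 0 := by
  simp [funext_iff, CM, Dmat, Matrix.mulVec, dotProduct]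

theorem det_CM_ne_zero {n : ℕ} [MetricSpace (Fin (n + 1))] {p : ℝ}
    (h : IsStrictCondNeg fun i j : Fin (n + 1) => dist i j ^ p) : (CM n p).det ≠ 0 := by
  intro hdet
  obtain ⟨v, hv, hmul⟩ := Matrix.exists_mulVec_eq_zero_iff.2 hdet
  obtain ⟨hsum, hrow⟩ := CM_mulVec_eq_zero_iff.1 hmul
  have hform : kernelForm (fun i j : Fin (n + 1) => dist i j ^ p) (fun i => v (Sum.inr i)) = 0 := by
    rw [kernelForm_eq_sum_mul]
    simp only [fun i => eq_neg_of_add_eq_zero_right (hrow i)]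
    rw [← Finset.sum_mul, hsum, zero_mul]
  have hinr : (fun i => v (Sum.inr i)) = 0 := by
    by_contra hne
    exact (h _ hsum hne).ne hform
  have hinl : v (Sum.inl 0) = 0 := by
    simpa [fun j => congrFun hinr j] using hrow 0
  refine hv (funext fun s => ?_)
  rcases s with a | i
  · rw [Subsingleton.elim a 0]
    exact hinl
  · exact congrFun hinr i

theorem isStrictCondNeg_of_det_CM_ne_zero {n : ℕ} [MetricSpace (Fin (n + 1))] {p : ℝ}
    (h : IsCondNeg fun i j : Fin (n + 1) => dist i j ^ p) (hdet : (CM n p).det ≠ 0) :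
    IsStrictCondNeg fun i j : Fin (n + 1) => dist i j ^ p := by
  intro ξ hξ hne
  refine lt_of_le_of_ne (h ξ hξ) fun hform => hdet ?_
  have hconst := h.sum_mul_eq_of_kernelForm_eq_zero (fun i j => by rw [dist_comm]) hξ hform
  refine Matrix.exists_mulVec_eq_zero_iff.1
    ⟨Sum.elim (fun _ => -∑ j, dist 0 j ^ p * ξ j) ξ, fun h0 => hne ?_, ?_⟩
  · exact funext fun i => congrFun h0 (Sum.inr i)
  · refine CM_mulVec_eq_zero_iff.2 ⟨hξ, fun i => ?_⟩
    simp [hconst i 0]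

theorem ne_mgr_of_isStrictCondNeg {n : ℕ} [MetricSpace (Fin (n + 1))]
    (hfin : BddAbove {p : ℝ | 0 ≤ p ∧ IsNegType (Fin (n + 1)) p}) {p : ℝ} (hp : 0 ≤ p)
    (h : IsStrictCondNeg (offDiagDist (Fin (n + 1)) p)) : p ≠ mgr (Fin (n + 1)) := by
  have hev := (h.eventually_isCondNeg continuous_offDiagDist).filter_mono
    (nhdsWithin_le_nhds (s := Ioi p))
  obtain ⟨q, hq, hpq⟩ := (hev.and self_mem_nhdsWithin).exists
  have hq0 : 0 < q := hp.trans_lt hpq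
  rw [offDiagDist_eq hq0.ne'] at hq
  exact (lt_of_lt_of_le hpq (le_csSup hfin ⟨hq0.le, isNegType_iff_isCondNeg.2 hq⟩)).ne

theorem isCondNeg_offDiagDist_mgr {n : ℕ} [MetricSpace (Fin (n + 1))]
    (hfin : BddAbove {p : ℝ | 0 ≤ p ∧ IsNegType (Fin (n + 1)) p}) :
    IsCondNeg (offDiagDist (Fin (n + 1)) (mgr (Fin (n + 1)))) := by
  have hclosed : IsClosed {p : ℝ | IsCondNeg (offDiagDist (Fin (n + 1)) p)} := by
    simp only [IsCondNeg, ofPred_forall]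
    refine isClosed_iInter fun ξ => isClosed_iInter fun _ => isClosed_le ?_ continuous_const
    exact continuous_finsetSum _ fun i _ => continuous_finsetSum _ fun j _ =>
      ((continuous_offDiagDist i j).mul_const _).mul_const _
  refine hclosed.closure_subset_iff.2 ?_ (csSup_mem_closure ?_ hfin)
  · rintro p ⟨-, hp⟩
    rcases eq_or_ne p 0 with rfl | hp0
    · intro ξ hξ
      by_cases hne : ξ = 0
      · simp [hne, kernelForm]
      · exact (isStrictCondNeg_offDiagDist_zero ξ hξ hne).le
    · rw [mem_ofPred_eq, offDiagDist_eq hp0]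
      exact isNegType_iff_isCondNeg.1 hp
  · refine ⟨0, le_rfl, fun N x ξ hξ => ?_⟩
    simp [← Finset.mul_sum, hξ]

theorem mgr_pos {n : ℕ} [MetricSpace (Fin (n + 1))]
    (hfin : BddAbove {p : ℝ | 0 ≤ p ∧ IsNegType (Fin (n + 1)) p}) :
    0 < mgr (Fin (n + 1)) :=
  lt_of_le_of_ne (Real.sSup_nonneg fun _ hp => hp.1)
    (ne_mgr_of_isStrictCondNeg hfin le_rfl isStrictCondNeg_offDiagDist_zero)

theorem isStrictCondNeg_of_lt_mgr {n : ℕ} [MetricSpace (Fin (n + 1))]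
    (hfin : BddAbove {p : ℝ | 0 ≤ p ∧ IsNegType (Fin (n + 1)) p}) {p : ℝ} (hp : 0 < p)
    (hlt : p < mgr (Fin (n + 1))) :
    IsStrictCondNeg fun i j : Fin (n + 1) => dist i j ^ p := by
  have hpos := mgr_pos hfin
  have hK := isCondNeg_offDiagDist_mgr hfin
  rw [offDiagDist_eq hpos.ne'] at hK
  have h := hK.isStrictCondNeg_rpow (fun i j => by rw [dist_comm])
    (fun i => by rw [dist_self, Real.zero_rpow hpos.ne'])
    (fun i j hij => Real.rpow_pos_of_pos (dist_pos.2 hij) _)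
    (div_pos hp hpos) ((div_lt_one hpos).2 hlt)
  simpa only [← Real.rpow_mul dist_nonneg, mul_div_cancel₀ _ hpos.ne'] using h

/-- If `℘ = mgr(X) < ∞`, then `℘ = min {p > 0 : det (M_p) = 0}`; in particular
`det (M_p) ≠ 0` for `0 < p < ℘` and `det (M_℘) = 0`. -/
theorem mgr_eq_min_det_cayleyMenger (n : ℕ) [MetricSpace (Fin (n + 1))]
    (hfin : BddAbove {p : ℝ | 0 ≤ p ∧ IsNegType (Fin (n + 1)) p}) :
    IsLeast {p : ℝ | 0 < p ∧ (CM n p).det = 0} (mgr (Fin (n + 1))) ∧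
      (∀ p : ℝ, 0 < p → p < mgr (Fin (n + 1)) → (CM n p).det ≠ 0) ∧
      (CM n (mgr (Fin (n + 1)))).det = 0 := by
  have hpos := mgr_pos hfin
  have hne : ∀ p : ℝ, 0 < p → p < mgr (Fin (n + 1)) → (CM n p).det ≠ 0 := fun p hp hlt =>
    det_CM_ne_zero (isStrictCondNeg_of_lt_mgr hfin hp hlt)
  have hdet : (CM n (mgr (Fin (n + 1)))).det = 0 := by
    by_contra hdet
    refine ne_mgr_of_isStrictCondNeg hfin hpos.le ?_ rfl
    have hK := isCondNeg_offDiagDist_mgr hfin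
    rw [offDiagDist_eq hpos.ne'] at hK ⊢
    exact isStrictCondNeg_of_det_CM_ne_zero hK hdet
  exact ⟨⟨⟨hpos, hdet⟩, fun p hp => not_lt.1 fun hlt => hne p hp.1 hlt hp.2⟩, hne, hdet⟩
end

section
/- Let (X,d) be a finite metric space X = {x_0, x_1, ..., x_n} with maximal generalised roundness ℘ = mgr(X) < ∞. Then ℘ = min{p > 0 : det(G_p) = 0}, where G_p is the Gramian matrix of X at exponent p. In particular, det(G_p) ≠ 0 for all 0 < p < ℘ and det(G_℘) = 0. -/
open Matrix BigOperators

/-- The Gramian `G_p` of the finite metric space `X = {x_0, …, x_n}` (modelled as a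
metric on `Fin (n+1)`): the `n × n` matrix with entries
`g_{ij} = ½ (d(x_i, x_0)^p + d(x_j, x_0)^p − d(x_i, x_j)^p)` for `1 ≤ i, j ≤ n`. -/
noncomputable def Gram (n : ℕ) [MetricSpace (Fin (n + 1))] (p : ℝ) :
    Matrix (Fin n) (Fin n) ℝ :=
  Matrix.of fun i j =>
    (dist i.succ (0 : Fin (n + 1)) ^ p + dist j.succ (0 : Fin (n + 1)) ^ p -
      dist i.succ j.succ ^ p) / 2

open Filter Topology MeasureTheory

/-- The real quadratic form of a matrix, written as a double sum. -/
lemma dotProduct_mulVec_eq_sum_sum {ι : Type*} [Fintype ι] (A : Matrix ι ι ℝ) (v : ι → ℝ) :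
    v ⬝ᵥ (A *ᵥ v) = ∑ i, ∑ j, A i j * v i * v j := by
  simp only [dotProduct, mulVec, Finset.mul_sum]
  exact Finset.sum_congr rfl fun i _ => Finset.sum_congr rfl fun j _ => by ring

/-- The entrywise exponential of a positive semidefinite matrix is positive semidefinite. -/
lemma Matrix.PosSemidef.map_exp {ι : Type*} [Fintype ι] {A : Matrix ι ι ℝ} (hA : A.PosSemidef) :
    (A.map Real.exp).PosSemidef := by
  have hJ : (Matrix.of fun _ _ : ι => (1 : ℝ)).PosSemidef := by
    simpa [vecMulVec] using posSemidef_vecMulVec_self_star (fun _ : ι => (1 : ℝ))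
  have hpow (B : Matrix ι ι ℝ) (hB : B.PosSemidef) (m : ℕ) : (B.map (· ^ m)).PosSemidef := by
    induction m with
    | zero => simpa [Matrix.map, Matrix.of] using hJ
    | succ m ih =>
      have h := ih.hadamard hB
      have e : B.map (· ^ (m + 1)) = B.map (· ^ m) ⊙ B := by
        ext i j
        simp [pow_succ]
      rwa [e]
  refine .of_dotProduct_mulVec_nonneg ?_ fun v => ?_
  · ext i j
    have := hA.isHermitian.apply i j
    simp only [star_trivial] at this
    simp [this]
  · have hlim : Tendsto (fun m : ℕ => ∑ i, ∑ j, (1 + A i j / m) ^ m * v i * v j) atTop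
        (𝓝 (∑ i, ∑ j, Real.exp (A i j) * v i * v j)) :=
      tendsto_finsetSum _ fun i _ => tendsto_finsetSum _ fun j _ =>
        ((Real.tendsto_one_add_div_pow_exp (A i j)).mul_const _).mul_const _
    rw [star_trivial, dotProduct_mulVec_eq_sum_sum]
    refine ge_of_tendsto' hlim fun m => ?_
    have hB := hpow _ (hJ.add (hA.smul (a := (m : ℝ)⁻¹) (by positivity))) m
    have := hB.dotProduct_mulVec_nonneg v
    rw [star_trivial, dotProduct_mulVec_eq_sum_sum] at this
    simpa [div_eq_inv_mul] using this

/-- Positive definiteness is an open condition on the quadratic form. -/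
lemma Matrix.PosDef.eventually_nonneg {ι : Type*} [Fintype ι] {A : Matrix ι ι ℝ}
    (hA : A.PosDef) : ∀ᶠ B in 𝓝 A, ∀ v : ι → ℝ, 0 ≤ v ⬝ᵥ (B *ᵥ v) := by
  have hK : IsCompact (Metric.sphere (0 : ι → ℝ) 1) := isCompact_sphere _ _
  have hpos : ∀ v ∈ Metric.sphere (0 : ι → ℝ) 1,
      ∀ᶠ z : Matrix ι ι ℝ × (ι → ℝ) in 𝓝 (A, v), 0 < z.2 ⬝ᵥ (z.1 *ᵥ z.2) := by
    intro v hv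
    have hv0 : v ≠ 0 := by
      rintro rfl
      simp at hv
    have hc : Continuous fun z : Matrix ι ι ℝ × (ι → ℝ) => z.2 ⬝ᵥ (z.1 *ᵥ z.2) := by
      fun_prop
    exact hc.continuousAt.eventually_const_lt (by simpa using hA.dotProduct_mulVec_pos hv0)
  have hev : ∀ᶠ B in 𝓝 A, ∀ v ∈ Metric.sphere (0 : ι → ℝ) 1, 0 < v ⬝ᵥ (B *ᵥ v) :=
    hK.eventually_forall_of_forall_eventually hpos
  filter_upwards [hev] with B hB v
  rcases eq_or_ne v 0 with rfl | hv
  · simp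
  · have hn : ‖v‖ ≠ 0 := norm_ne_zero_iff.mpr hv
    have h := (hB (‖v‖⁻¹ • v) (by simp [norm_smul, hn])).le
    rw [mulVec_smul, dotProduct_smul, smul_dotProduct, smul_eq_mul, smul_eq_mul] at h
    have : 0 < ‖v‖⁻¹ := by positivity
    exact nonneg_of_mul_nonneg_right (nonneg_of_mul_nonneg_right h this) this

section Schoenberg

variable {ι : Type*} [Fintype ι] {D : ι → ι → ℝ}

/-- **Schoenberg's theorem**: if `D` is conditionally negative, `exp (-s D)` is positive. -/
lemma sum_exp_neg_mul_nonneg (hsymm : ∀ i j, D i j = D j i) (hdiag : ∀ i, D i i = 0)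
    (hneg : ∀ ξ : ι → ℝ, ∑ i, ξ i = 0 → ∑ i, ∑ j, D i j * ξ i * ξ j ≤ 0)
    {s : ℝ} (hs : 0 ≤ s) (ξ : ι → ℝ) :
    0 ≤ ∑ i, ∑ j, Real.exp (-(s * D i j)) * ξ i * ξ j := by
  classical
  rcases isEmpty_or_nonempty ι with _ | ⟨⟨o⟩⟩
  · simp
  let K : Matrix ι ι ℝ := .of fun i j => D i o + D o j - D i j
  have hK : K.PosSemidef := by
    refine .of_dotProduct_mulVec_nonneg ?_ fun v => ?_
    · ext i j
      simp [K, hsymm i j, hsymm i o, hsymm j o, add_comm]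
    · rw [star_trivial, dotProduct_mulVec_eq_sum_sum]
      have h := hneg (fun i => v i - (∑ k, v k) * (if i = o then 1 else 0)) (by simp)
      have e : ∑ i, ∑ j, D i j * (v i - (∑ k, v k) * (if i = o then 1 else 0)) *
          (v j - (∑ k, v k) * (if j = o then 1 else 0)) = -∑ i, ∑ j, K i j * v i * v j := by
        have h1 : ∑ i, ∑ j, D i o * v i * v j = (∑ i, D i o * v i) * ∑ k, v k := by
          rw [Finset.sum_mul_sum]
        have h2 : ∑ i, ∑ j, D o j * v i * v j = (∑ i, D i o * v i) * ∑ k, v k := by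
          rw [mul_comm, Finset.sum_mul_sum]
          refine Finset.sum_congr rfl fun i _ => Finset.sum_congr rfl fun j _ => ?_
          rw [hsymm o j]
          ring
        simp only [K, of_apply, sub_mul, add_mul, mul_sub, Finset.sum_add_distrib,
          Finset.sum_sub_distrib, h1, h2]
        have h3 : ∑ i, (D i o * ∑ k, v k) * v i = (∑ i, D i o * v i) * ∑ k, v k := by
          rw [Finset.sum_mul]
          exact Finset.sum_congr rfl fun i _ => by ring
        simp [hdiag, ← Finset.sum_mul, hsymm o, h3]
        ring
      linarith
  have h := (hK.smul hs).map_exp.dotProduct_mulVec_nonneg fun i => Real.exp (-(s * D i o)) * ξ i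
  rw [star_trivial, dotProduct_mulVec_eq_sum_sum] at h
  refine h.trans_eq (Finset.sum_congr rfl fun i _ => Finset.sum_congr rfl fun j _ => ?_)
  have : Real.exp (-(s * D i j)) =
      Real.exp (s * K i j) * Real.exp (-(s * D i o)) * Real.exp (-(s * D j o)) := by
    rw [← Real.exp_add, ← Real.exp_add, hsymm j o]
    congr 1
    simp only [K, of_apply]
    ring
  rw [this]
  simp only [map_apply, Matrix.smul_apply, smul_eq_mul]
  ring

/-- The resolvent kernel of a conditionally negative kernel is positive. -/
lemma sum_inv_add_nonneg (hsymm : ∀ i j, D i j = D j i) (hdiag : ∀ i, D i i = 0)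
    (hD : ∀ i j, 0 ≤ D i j)
    (hneg : ∀ ξ : ι → ℝ, ∑ i, ξ i = 0 → ∑ i, ∑ j, D i j * ξ i * ξ j ≤ 0)
    {t : ℝ} (ht : 0 < t) (ξ : ι → ℝ) :
    0 ≤ ∑ i, ∑ j, (t + D i j)⁻¹ * ξ i * ξ j := by
  have ha (i j) : -(t + D i j) < 0 := by linarith [hD i j]
  have hint (i j) : IntegrableOn (fun s => Real.exp (-(t + D i j) * s) * ξ i * ξ j) (Set.Ioi 0) :=
    ((integrableOn_exp_mul_Ioi (ha i j) 0).mul_const _).mul_const _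
  have e : ∑ i, ∑ j, (t + D i j)⁻¹ * ξ i * ξ j =
      ∫ s in Set.Ioi (0 : ℝ), ∑ i, ∑ j, Real.exp (-(t + D i j) * s) * ξ i * ξ j := by
    rw [integral_finsetSum _ fun i _ => integrable_finsetSum _ fun j _ => hint i j]
    refine Finset.sum_congr rfl fun i _ => ?_
    rw [integral_finsetSum _ fun j _ => hint i j]
    refine Finset.sum_congr rfl fun j _ => ?_
    rw [integral_mul_const, integral_mul_const, integral_exp_mul_Ioi (ha i j)]
    rw [mul_zero, Real.exp_zero, neg_div_neg_eq, one_div]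
  rw [e]
  refine setIntegral_nonneg measurableSet_Ioi fun s hs => ?_
  have h := mul_nonneg (Real.exp_pos (-(t * s))).le
    (sum_exp_neg_mul_nonneg hsymm hdiag hneg (le_of_lt hs) ξ)
  refine h.trans_eq ?_
  simp only [Finset.mul_sum]
  refine Finset.sum_congr rfl fun i _ => Finset.sum_congr rfl fun j _ => ?_
  rw [← mul_assoc, ← mul_assoc, ← Real.exp_add]
  ring_nf

/-- The resolvent kernel is eventually strictly positive near `0`. -/
lemma eventually_sum_inv_add_pos (hdiag : ∀ i, D i i = 0) (hD : ∀ i j, i ≠ j → 0 < D i j)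
    {ξ : ι → ℝ} (hξ : ξ ≠ 0) :
    ∀ᶠ t in 𝓝[>] (0 : ℝ), 0 < ∑ i, ∑ j, (t + D i j)⁻¹ * ξ i * ξ j := by
  classical
  have hlim : Tendsto (fun t : ℝ => ∑ i, ∑ j, (t * (t + D i j)⁻¹) * ξ i * ξ j) (𝓝[>] 0)
      (𝓝 (∑ i, ∑ j, (if i = j then 1 else 0) * ξ i * ξ j)) := by
    refine tendsto_finsetSum _ fun i _ => tendsto_finsetSum _ fun j _ =>
      Tendsto.mul_const _ (Tendsto.mul_const _ ?_)
    split_ifs with hij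
    · subst hij
      refine tendsto_const_nhds.congr' ?_
      filter_upwards [self_mem_nhdsWithin] with t ht
      rw [hdiag, add_zero, mul_inv_cancel₀ (ne_of_gt ht)]
    · have hc : ContinuousAt (fun t : ℝ => t * (t + D i j)⁻¹) 0 :=
        continuousAt_id.mul ((continuousAt_id.add continuousAt_const).inv₀
          (by simpa using (hD i j hij).ne'))
      simpa using hc.tendsto.mono_left nhdsWithin_le_nhds
  have hpos : 0 < ∑ i, ∑ j, (if i = j then 1 else 0) * ξ i * ξ j := by
    obtain ⟨k, hk⟩ := Function.ne_iff.mp hξ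
    simp only [ite_mul, one_mul, zero_mul, Finset.sum_ite_eq, Finset.mem_univ, if_true]
    exact Finset.sum_pos' (fun i _ => mul_self_nonneg _)
      ⟨k, Finset.mem_univ _, mul_self_pos.mpr hk⟩
  filter_upwards [hlim.eventually_const_lt hpos, self_mem_nhdsWithin] with t ht ht0
  refine pos_of_mul_pos_right (a := t) ?_ (le_of_lt ht0)
  simpa only [Finset.mul_sum, mul_assoc] using ht

/-- A fractional power of a conditionally negative kernel is strictly conditionally negative. -/
lemma sum_rpow_neg (hsymm : ∀ i j, D i j = D j i) (hdiag : ∀ i, D i i = 0)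
    (hD : ∀ i j, i ≠ j → 0 < D i j)
    (hneg : ∀ ξ : ι → ℝ, ∑ i, ξ i = 0 → ∑ i, ∑ j, D i j * ξ i * ξ j ≤ 0)
    {α : ℝ} (hα : α ∈ Set.Ioo (0 : ℝ) 1) {ξ : ι → ℝ} (hξ : ξ ≠ 0) (hsum : ∑ i, ξ i = 0) :
    ∑ i, ∑ j, D i j ^ α * ξ i * ξ j < 0 := by
  have hD0 (i j) : 0 ≤ D i j := by
    rcases eq_or_ne i j with rfl | h
    · exact (hdiag i).ge
    · exact (hD i j h).le
  set F : ℝ → ℝ := fun t => ∑ i, ∑ j, (t + D i j)⁻¹ * ξ i * ξ j with hF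
  have hint (i j) : IntegrableOn (fun t => Real.rpowIntegrand₀₁ α t (D i j) * ξ i * ξ j)
      (Set.Ioi 0) :=
    ((Real.integrableOn_rpowIntegrand₀₁_Ioi hα (hD0 i j)).mul_const _).mul_const _
  have hsumint (t : ℝ) : ∑ i, ∑ j, Real.rpowIntegrand₀₁ α t (D i j) * ξ i * ξ j =
      -(t ^ α * F t) := by
    have h0 : ∑ i, ∑ j, t ^ α * t⁻¹ * ξ i * ξ j = 0 := by
      simp [← Finset.mul_sum, hsum]
    simp only [Real.rpowIntegrand₀₁, mul_sub, sub_mul, Finset.sum_sub_distrib, h0, zero_sub]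
    simp only [hF, Finset.mul_sum, mul_assoc]
  have hintF : IntegrableOn (fun t => t ^ α * F t) (Set.Ioi 0) := by
    have h : IntegrableOn (fun t => ∑ i, ∑ j, Real.rpowIntegrand₀₁ α t (D i j) * ξ i * ξ j)
        (Set.Ioi 0) :=
      integrable_finsetSum _ fun i _ => integrable_finsetSum _ fun j _ => hint i j
    simpa [hsumint] using h.neg
  have hFpos : 0 < ∫ t in Set.Ioi (0 : ℝ), t ^ α * F t := by
    rw [setIntegral_pos_iff_support_of_nonneg_ae _ hintF]
    · obtain ⟨b, hb, hsub⟩ := mem_nhdsGT_iff_exists_Ioo_subset.mp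
        (eventually_sum_inv_add_pos hdiag hD hξ)
      have hb0 : 0 < b := hb
      refine lt_of_lt_of_le (b := volume (Set.Ioo 0 b)) (by simpa using hb0)
        (measure_mono fun t ht => ⟨?_, ht.1⟩)
      exact (mul_pos (Real.rpow_pos_of_pos ht.1 α) (hsub ht)).ne'
    · filter_upwards [ae_restrict_mem measurableSet_Ioi] with t ht
      exact mul_nonneg (Real.rpow_nonneg (le_of_lt ht) α)
        (sum_inv_add_nonneg hsymm hdiag hD0 hneg ht ξ)
  have e : ∑ i, ∑ j, D i j ^ α * ξ i * ξ j =
      (∫ t in Set.Ioi 0, Real.rpowIntegrand₀₁ α t 1)⁻¹ *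
        ∫ t in Set.Ioi (0 : ℝ), ∑ i, ∑ j, Real.rpowIntegrand₀₁ α t (D i j) * ξ i * ξ j := by
    rw [integral_finsetSum _ fun i _ => integrable_finsetSum _ fun j _ => hint i j,
      Finset.mul_sum]
    refine Finset.sum_congr rfl fun i _ => ?_
    rw [integral_finsetSum _ fun j _ => hint i j, Finset.mul_sum]
    refine Finset.sum_congr rfl fun j _ => ?_
    rw [integral_mul_const, integral_mul_const, Real.rpow_eq_const_mul_integral hα (hD0 i j)]
    ring
  rw [e]
  simp only [hsumint, integral_neg, mul_neg, neg_lt_zero]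
  exact mul_pos (inv_pos.mpr (Real.integral_rpowIntegrand₀₁_one_pos hα)) hFpos

end Schoenberg

section NegType

/-- On a finite space, negative type may be tested on one weight per point. -/
lemma isNegType_iff_forall_weights {X : Type*} [Fintype X] [MetricSpace X] {p : ℝ} :
    IsNegType X p ↔
      ∀ ξ : X → ℝ, ∑ i, ξ i = 0 → ∑ i, ∑ j, dist i j ^ p * ξ i * ξ j ≤ 0 := by
  classical
  constructor
  · intro h ξ hξ
    let e := (Fintype.equivFin X).symm
    have h1 := h _ e (fun i => ξ (e i)) (by rw [e.sum_comp, hξ])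
    rw [e.sum_comp fun a => ∑ j, dist a (e j) ^ p * ξ a * ξ (e j)] at h1
    simpa only [fun a => e.sum_comp fun b => dist a b ^ p * ξ a * ξ b] using h1
  · intro h N x ξ hξ
    have hpush (f : X → ℝ) : ∑ a, f a * ∑ i with x i = a, ξ i = ∑ i, f (x i) * ξ i := by
      rw [← Finset.sum_fiberwise Finset.univ x]
      refine Finset.sum_congr rfl fun a _ => ?_
      rw [Finset.mul_sum]
      refine Finset.sum_congr rfl fun i hi => ?_
      rw [(Finset.mem_filter.mp hi).2]
    have h1 := h (fun a => ∑ i with x i = a, ξ i) (by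
      simpa [hξ] using hpush fun _ => 1)
    refine le_trans (le_of_eq ?_) h1
    have e1 : ∀ a, ∑ b, dist a b ^ p * (∑ i with x i = a, ξ i) * ∑ i with x i = b, ξ i =
        (∑ j, dist a (x j) ^ p * ξ j) * ∑ i with x i = a, ξ i := by
      intro a
      rw [hpush fun b => dist a b ^ p * (∑ i with x i = a, ξ i), Finset.sum_mul]
      exact Finset.sum_congr rfl fun j _ => by ring
    simp only [e1]
    rw [hpush fun a => ∑ j, dist a (x j) ^ p * ξ j]
    refine Finset.sum_congr rfl fun i _ => ?_
    rw [Finset.sum_mul]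
    exact Finset.sum_congr rfl fun j _ => by ring

/-- Smaller positive exponents than one of negative type are of strict negative type. -/
lemma IsNegType.sum_lt_zero {X : Type*} [Fintype X] [MetricSpace X] {p q : ℝ}
    (hp : IsNegType X p) (hq : 0 < q) (hqp : q < p) {ξ : X → ℝ} (hξ : ξ ≠ 0)
    (hsum : ∑ i, ξ i = 0) : ∑ i, ∑ j, dist i j ^ q * ξ i * ξ j < 0 := by
  have hp0 : 0 < p := hq.trans hqp
  have h := sum_rpow_neg (D := fun i j : X => dist i j ^ p) (fun i j => by rw [dist_comm])
    (fun i => by rw [dist_self, Real.zero_rpow hp0.ne'])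
    (fun i j hij => Real.rpow_pos_of_pos (dist_pos.mpr hij) p)
    (isNegType_iff_forall_weights.mp hp)
    (α := q / p) ⟨by positivity, (div_lt_one hp0).mpr hqp⟩ hξ hsum
  simpa only [← Real.rpow_mul dist_nonneg, mul_div_cancel₀ q hp0.ne'] using h

/-- Every vector on the non-base points extends to a weight of total mass zero. -/
lemma exists_sum_eq_zero_comp_succ {n : ℕ} (v : Fin n → ℝ) :
    ∃ ξ : Fin (n + 1) → ℝ, ∑ i, ξ i = 0 ∧ ξ ∘ Fin.succ = v :=
  ⟨Fin.cons (-∑ i, v i) v, by simp [Fin.sum_univ_succ], by ext i; simp⟩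

variable {n : ℕ} [MetricSpace (Fin (n + 1))]

lemma gram_isHermitian (p : ℝ) : (Gram n p).IsHermitian := by
  ext i j
  simp [Gram, dist_comm i.succ j.succ, add_comm]

/-- The quadratic form of the Gramian in terms of the distance kernel. -/
lemma dotProduct_gram_mulVec {p : ℝ} (hp : p ≠ 0) (ξ : Fin (n + 1) → ℝ) (hξ : ∑ i, ξ i = 0) :
    (ξ ∘ Fin.succ) ⬝ᵥ (Gram n p *ᵥ (ξ ∘ Fin.succ)) =
      -(∑ i, ∑ j, dist i j ^ p * ξ i * ξ j) / 2 := by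
  rw [dotProduct_mulVec_eq_sum_sum]
  rw [Fin.sum_univ_succ] at hξ
  set S := ∑ i : Fin n, dist i.succ (0 : Fin (n + 1)) ^ p * ξ i.succ with hS
  have h1 : ∑ i : Fin n, ∑ j : Fin n, dist i.succ (0 : Fin (n + 1)) ^ p * ξ i.succ * ξ j.succ =
      S * ∑ i : Fin n, ξ i.succ := by
    rw [Finset.sum_mul_sum]
  have h2 : ∑ i : Fin n, ∑ j : Fin n, dist j.succ (0 : Fin (n + 1)) ^ p * ξ i.succ * ξ j.succ =
      S * ∑ i : Fin n, ξ i.succ := by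
    rw [mul_comm, Finset.sum_mul_sum]
    exact Finset.sum_congr rfl fun i _ => Finset.sum_congr rfl fun j _ => by ring
  have h3 : ∑ i : Fin n, ∑ j : Fin n, Gram n p i j * ξ i.succ * ξ j.succ =
      (S * ∑ i : Fin n, ξ i.succ + S * ∑ i : Fin n, ξ i.succ -
        ∑ i : Fin n, ∑ j : Fin n, dist i.succ j.succ ^ p * ξ i.succ * ξ j.succ) / 2 := by
    nth_rewrite 1 [← h1]
    rw [← h2, ← Finset.sum_add_distrib, ← Finset.sum_sub_distrib, Finset.sum_div]
    refine Finset.sum_congr rfl fun i _ => ?_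
    rw [← Finset.sum_add_distrib, ← Finset.sum_sub_distrib, Finset.sum_div]
    refine Finset.sum_congr rfl fun j _ => ?_
    simp only [Gram, of_apply]
    ring
  have h4 : ∑ j : Fin n, dist (0 : Fin (n + 1)) j.succ ^ p * ξ 0 * ξ j.succ = ξ 0 * S := by
    rw [hS, Finset.mul_sum]
    refine Finset.sum_congr rfl fun j _ => ?_
    rw [dist_comm]
    ring
  have h5 : ∑ i : Fin n, dist i.succ (0 : Fin (n + 1)) ^ p * ξ i.succ * ξ 0 = ξ 0 * S := by
    rw [← Finset.sum_mul, mul_comm]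
  simp only [Function.comp_apply]
  rw [h3, Fin.sum_univ_succ]
  simp only [Fin.sum_univ_succ (n := n), Finset.sum_add_distrib]
  rw [h4, h5, dist_self, Real.zero_rpow hp, show ∑ i : Fin n, ξ i.succ = -ξ 0 by linarith]
  ring

lemma isNegType_iff_gram_nonneg {p : ℝ} (hp : p ≠ 0) :
    IsNegType (Fin (n + 1)) p ↔ ∀ v : Fin n → ℝ, 0 ≤ v ⬝ᵥ (Gram n p *ᵥ v) := by
  rw [isNegType_iff_forall_weights]
  constructor
  · intro h v
    obtain ⟨ξ, hξ, rfl⟩ := exists_sum_eq_zero_comp_succ v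
    rw [dotProduct_gram_mulVec hp ξ hξ]
    linarith [h ξ hξ]
  · intro h ξ hξ
    have := h (ξ ∘ Fin.succ)
    rw [dotProduct_gram_mulVec hp ξ hξ] at this
    linarith

lemma IsNegType.gram_posDef {p q : ℝ} (hp : IsNegType (Fin (n + 1)) p) (hq : 0 < q)
    (hqp : q < p) : (Gram n q).PosDef := by
  refine .of_dotProduct_mulVec_pos (gram_isHermitian q) fun v hv => ?_
  obtain ⟨ξ, hξ, rfl⟩ := exists_sum_eq_zero_comp_succ v
  have hξ0 : ξ ≠ 0 := by
    rintro rfl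
    exact hv rfl
  rw [star_trivial, dotProduct_gram_mulVec hq.ne' ξ hξ]
  linarith [hp.sum_lt_zero hq hqp hξ0 hξ]

lemma continuousAt_gram {p : ℝ} (hp : p ≠ 0) : ContinuousAt (Gram n) p := by
  have hc (x : ℝ) : ContinuousAt (fun q : ℝ => x ^ q) p := Real.continuousAt_const_rpow' hp
  refine continuousAt_pi.mpr fun i => continuousAt_pi.mpr fun j => ?_
  exact (((hc _).add (hc _)).sub (hc _)).div_const 2

/-- As `p` decreases to `0`, the Gramian tends to the one of the discrete metric. -/
lemma tendsto_gram_zero :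
    Tendsto (Gram n) (𝓝[>] 0)
      (𝓝 ((2⁻¹ : ℝ) • (1 + vecMulVec (fun _ => 1) (star fun _ => 1)))) := by
  have hc (a b : Fin (n + 1)) : Tendsto (fun q : ℝ => dist a b ^ q) (𝓝[>] 0)
      (𝓝 (if a = b then 0 else 1)) := by
    split_ifs with hab
    · subst hab
      refine tendsto_const_nhds.congr' ?_
      filter_upwards [self_mem_nhdsWithin] with q hq
      rw [dist_self, Real.zero_rpow (ne_of_gt hq)]
    · have h : ContinuousAt (fun q : ℝ => dist a b ^ q) 0 :=
        Real.continuousAt_const_rpow (dist_ne_zero.mpr hab)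
      simpa using h.tendsto.mono_left nhdsWithin_le_nhds
  refine tendsto_pi_nhds.mpr fun i => tendsto_pi_nhds.mpr fun j => ?_
  have h := (((hc i.succ 0).add (hc j.succ 0)).sub (hc i.succ j.succ)).div_const 2
  have e : ((2⁻¹ : ℝ) • (1 + vecMulVec (fun _ => 1) (star fun _ => 1)) :
      Matrix (Fin n) (Fin n) ℝ) i j =
      ((if i.succ = 0 then 0 else 1) + (if j.succ = 0 then 0 else 1) -
        (if i.succ = j.succ then 0 else 1)) / 2 := by
    rcases eq_or_ne i j with rfl | hij
    · simp [vecMulVec_apply]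
      norm_num
    · simp [vecMulVec_apply, hij]
  rw [e]
  exact h

/-- A finite metric space has `p`-negative type for some `p > 0`. -/
lemma exists_pos_isNegType : ∃ p : ℝ, 0 < p ∧ IsNegType (Fin (n + 1)) p := by
  have hpd : ((2⁻¹ : ℝ) • (1 + vecMulVec (fun _ => 1) (star fun _ => 1)) :
      Matrix (Fin n) (Fin n) ℝ).PosDef :=
    (PosDef.one.add_posSemidef (posSemidef_vecMulVec_self_star _)).smul (by norm_num)
  obtain ⟨p, hp, hp0⟩ :=
    ((tendsto_gram_zero.eventually hpd.eventually_nonneg).and self_mem_nhdsWithin).exists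
  exact ⟨p, hp0, (isNegType_iff_gram_nonneg (ne_of_gt hp0)).mpr hp⟩

end NegType

/-- If `℘ = mgr(X) < ∞`, then `℘ = min {p > 0 : det (G_p) = 0}`; in particular
`det (G_p) ≠ 0` for `0 < p < ℘` and `det (G_℘) = 0`. -/
theorem mgr_eq_min_det_gramian (n : ℕ) [MetricSpace (Fin (n + 1))]
    (hfin : BddAbove {p : ℝ | 0 ≤ p ∧ IsNegType (Fin (n + 1)) p}) :
    IsLeast {p : ℝ | 0 < p ∧ (Gram n p).det = 0} (mgr (Fin (n + 1))) ∧
      (∀ p : ℝ, 0 < p → p < mgr (Fin (n + 1)) → (Gram n p).det ≠ 0) ∧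
      (Gram n (mgr (Fin (n + 1)))).det = 0 := by
  set S := {p : ℝ | 0 ≤ p ∧ IsNegType (Fin (n + 1)) p}
  obtain ⟨p₀, hp₀, hp₀S⟩ := exists_pos_isNegType (n := n)
  have hne : S.Nonempty := ⟨p₀, hp₀.le, hp₀S⟩
  have hpos : 0 < mgr (Fin (n + 1)) := hp₀.trans_le (le_csSup hfin ⟨hp₀.le, hp₀S⟩)
  have hlt : ∀ p : ℝ, 0 < p → p < mgr (Fin (n + 1)) → (Gram n p).PosDef := by
    intro p hp hpm
    obtain ⟨r, hr, hpr⟩ := exists_lt_of_lt_csSup hne hpm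
    exact hr.2.gram_posDef hp hpr
  have hsemi : (Gram n (mgr (Fin (n + 1)))).PosSemidef := by
    refine .of_dotProduct_mulVec_nonneg (gram_isHermitian _) fun v => ?_
    have hcont : Continuous fun A : Matrix (Fin n) (Fin n) ℝ => star v ⬝ᵥ (A *ᵥ v) := by
      fun_prop
    refine ge_of_tendsto ((hcont.continuousAt.comp (continuousAt_gram hpos.ne')).tendsto.mono_left
      (nhdsWithin_le_nhds (s := Set.Iio (mgr (Fin (n + 1)))))) ?_
    filter_upwards [Ioo_mem_nhdsLT hpos] with p hp
    exact (hlt p hp.1 hp.2).posSemidef.dotProduct_mulVec_nonneg v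
  have hdet : (Gram n (mgr (Fin (n + 1)))).det = 0 := by
    by_contra hdet
    have hev := (continuousAt_gram hpos.ne').eventually
      (hsemi.posDef_iff_det_ne_zero.mpr hdet).eventually_nonneg
    obtain ⟨p, hp, hmp⟩ := ((hev.filter_mono nhdsWithin_le_nhds).and
      (self_mem_nhdsWithin (s := Set.Ioi (mgr (Fin (n + 1)))))).exists
    have hp0 : 0 < p := hpos.trans hmp
    exact (le_csSup hfin ⟨hp0.le, (isNegType_iff_gram_nonneg hp0.ne').mpr hp⟩).not_gt hmp
  have hdetlt : ∀ p : ℝ, 0 < p → p < mgr (Fin (n + 1)) → (Gram n p).det ≠ 0 :=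
    fun p hp hpm => (hlt p hp hpm).det_pos.ne'
  exact ⟨⟨⟨hpos, hdet⟩, fun p hp => not_lt.mp fun hpm => hdetlt p hp.1 hpm hp.2⟩, hdetlt, hdet⟩
end

section
/- (Sánchez's dichotomy) Let X = {x_0,...,x_n} be a finite metric space with ℘ = mgr(X) < ∞, and let Π_0 be the hyperplane in ℝ^{n+1} given by ξ_0 + ξ_1 + ... + ξ_n = 0. Then exactly one of the following holds: (1) det(D_℘) = 0, and every ξ ∈ ker(D_℘) lies in Π_0; or (2) det(D_℘) ≠ 0 and ⟨D_℘^{-1}𝟙, 𝟙⟩ = 0. -/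
open Matrix BigOperators

/-- A vector that is isotropic for a symmetric matrix which is negative semidefinite on the
hyperplane of vectors of sum zero is mapped by this matrix to a constant vector. -/
theorem Matrix.IsSymm.exists_mulVec_eq_const {ι : Type*} [Fintype ι] [Nonempty ι]
    {A : Matrix ι ι ℝ} (hA : A.IsSymm)
    (hneg : ∀ v : ι → ℝ, ∑ i, v i = 0 → v ⬝ᵥ A *ᵥ v ≤ 0) {w : ι → ℝ}
    (hw : ∑ i, w i = 0) (hw0 : w ⬝ᵥ A *ᵥ w = 0) : ∃ c : ℝ, A *ᵥ w = fun _ => c := by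
  classical
  have hsymm (u v : ι → ℝ) : u ⬝ᵥ A *ᵥ v = v ⬝ᵥ A *ᵥ u := by
    rw [dotProduct_mulVec, ← mulVec_transpose, hA.eq, dotProduct_comm]
  have horth (v : ι → ℝ) (hv : ∑ i, v i = 0) : v ⬝ᵥ A *ᵥ w = 0 := by
    have ha := hneg v hv
    have key (t : ℝ) : 2 * t * (v ⬝ᵥ A *ᵥ w) + t ^ 2 * (v ⬝ᵥ A *ᵥ v) ≤ 0 := by
      have h := hneg (w + t • v) (by simp [Finset.sum_add_distrib, ← Finset.mul_sum, hw, hv])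
      simp only [mulVec_add, mulVec_smul, add_dotProduct, dotProduct_add, smul_dotProduct,
        dotProduct_smul, smul_eq_mul, hw0, hsymm w v] at h
      linarith
    generalize v ⬝ᵥ A *ᵥ w = b at *
    generalize v ⬝ᵥ A *ᵥ v = a at *
    have ha' : 0 < 1 - a := by linarith
    have h := key (b / (1 - a))
    have h2 : 2 * (b / (1 - a)) * b + (b / (1 - a)) ^ 2 * a = (b / (1 - a)) ^ 2 * (2 - a) := by
      field_simp
      ring
    rw [h2] at h
    by_contra hb
    have : 0 < (b / (1 - a)) ^ 2 * (2 - a) := by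
      have : 0 < 2 - a := by linarith
      positivity
    linarith
  obtain ⟨k⟩ := ‹Nonempty ι›
  refine ⟨(A *ᵥ w) k, funext fun i => ?_⟩
  have h := horth (Pi.single i 1 - Pi.single k 1) (by simp)
  simp only [sub_dotProduct, single_dotProduct, one_mul] at h
  linarith

theorem Dmat_isSymm (n : ℕ) [MetricSpace (Fin (n + 1))] (p : ℝ) : (Dmat n p).IsSymm := by
  ext i j
  simp [Dmat, dist_comm]

theorem dotProduct_Dmat_mulVec (n : ℕ) [MetricSpace (Fin (n + 1))] (p : ℝ)
    (v : Fin (n + 1) → ℝ) :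
    v ⬝ᵥ Dmat n p *ᵥ v = ∑ i, ∑ j, dist i j ^ p * v i * v j := by
  simp only [dotProduct, mulVec, Dmat, of_apply, Finset.mul_sum]
  exact Finset.sum_congr rfl fun i _ => Finset.sum_congr rfl fun j _ => by ring

theorem isNegType_iff_Dmat (n : ℕ) [MetricSpace (Fin (n + 1))] (p : ℝ) :
    IsNegType (Fin (n + 1)) p ↔
      ∀ v : Fin (n + 1) → ℝ, ∑ i, v i = 0 → v ⬝ᵥ Dmat n p *ᵥ v ≤ 0 := by
  refine ⟨fun h v hv => ?_, fun h N x ξ hξ => ?_⟩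
  · rw [dotProduct_Dmat_mulVec]
    exact h (n + 1) id v hv
  · let v : Fin (n + 1) → ℝ := fun a => ∑ i, if x i = a then ξ i else 0
    have hv : ∑ a, v a = 0 := by
      simp only [v]
      rw [Finset.sum_comm]
      simpa using hξ
    have hsum (f : Fin (n + 1) → ℝ) : ∑ a, f a * v a = ∑ i, f (x i) * ξ i := by
      simp only [v, Finset.mul_sum]
      rw [Finset.sum_comm]
      simp
    have key := h v hv
    rw [dotProduct_Dmat_mulVec] at key
    calc ∑ i, ∑ j, dist (x i) (x j) ^ p * ξ i * ξ j
        = ∑ i, (∑ b, dist (x i) b ^ p * v b) * ξ i := by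
          refine Finset.sum_congr rfl fun i _ => ?_
          rw [hsum fun b => dist (x i) b ^ p, Finset.sum_mul]
          exact Finset.sum_congr rfl fun j _ => by ring
      _ = ∑ a, ∑ b, dist a b ^ p * v a * v b := by
          rw [← hsum fun a => ∑ b, dist a b ^ p * v b]
          refine Finset.sum_congr rfl fun a _ => ?_
          rw [Finset.sum_mul]
          exact Finset.sum_congr rfl fun b _ => by ring
      _ ≤ 0 := key

theorem dotProduct_Dmat_zero_mulVec (n : ℕ) [MetricSpace (Fin (n + 1))]
    (v : Fin (n + 1) → ℝ) : v ⬝ᵥ Dmat n 0 *ᵥ v = (∑ i, v i) ^ 2 := by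
  simp [dotProduct_Dmat_mulVec, sq, Finset.sum_mul_sum]

theorem isNegType_zero (n : ℕ) [MetricSpace (Fin (n + 1))] : IsNegType (Fin (n + 1)) 0 := by
  rw [isNegType_iff_Dmat]
  intro v hv
  simp [dotProduct_Dmat_zero_mulVec, hv]

theorem continuousAt_dotProduct_Dmat_mulVec (n : ℕ) [MetricSpace (Fin (n + 1))] {p : ℝ}
    (hp : 0 < p) (v : Fin (n + 1) → ℝ) :
    ContinuousAt (fun z : ℝ × (Fin (n + 1) → ℝ) => z.2 ⬝ᵥ Dmat n z.1 *ᵥ z.2) (p, v) := by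
  simp only [dotProduct_Dmat_mulVec]
  refine tendsto_finsetSum _ fun i _ => tendsto_finsetSum _ fun j _ => ?_
  have h : ContinuousAt (fun z : ℝ × (Fin (n + 1) → ℝ) => dist i j ^ z.1) (p, v) :=
    continuousAt_const.rpow continuousAt_fst (Or.inr hp)
  exact (h.mul (by fun_prop)).mul (by fun_prop)

theorem mgr_nonneg (X : Type*) [MetricSpace X] : 0 ≤ mgr X :=
  Real.sSup_nonneg fun _ h => h.1

theorem isNegType_mgr (n : ℕ) [MetricSpace (Fin (n + 1))]
    (hfin : BddAbove {p : ℝ | 0 ≤ p ∧ IsNegType (Fin (n + 1)) p}) :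
    IsNegType (Fin (n + 1)) (mgr (Fin (n + 1))) := by
  rcases (mgr_nonneg (Fin (n + 1))).eq_or_lt with h0 | hpos
  · rw [← h0]
    exact isNegType_zero n
  · rw [isNegType_iff_Dmat]
    intro v hv
    by_contra! hlt
    have hcont : ContinuousAt (fun p : ℝ => v ⬝ᵥ Dmat n p *ᵥ v) (mgr (Fin (n + 1))) :=
      (continuousAt_dotProduct_Dmat_mulVec n hpos v).comp
        (f := fun p : ℝ => (p, v)) (by fun_prop)
    have hmem : mgr (Fin (n + 1)) ∈ closure {p : ℝ | 0 ≤ p ∧ IsNegType (Fin (n + 1)) p} :=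
      csSup_mem_closure ⟨0, le_rfl, isNegType_zero n⟩ hfin
    obtain ⟨p, hp, hp'⟩ :=
      ((mem_closure_iff_frequently.1 hmem).and_eventually
        (hcont.eventually (lt_mem_nhds hlt))).exists
    exact absurd ((isNegType_iff_Dmat n p).1 hp.2 v hv) (not_le.2 hp')

open Topology in
/-- Negative type is not strict at the maximal generalised roundness. -/
theorem exists_dotProduct_Dmat_mgr_mulVec_eq_zero (n : ℕ) [MetricSpace (Fin (n + 1))]
    (hfin : BddAbove {p : ℝ | 0 ≤ p ∧ IsNegType (Fin (n + 1)) p}) :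
    ∃ v : Fin (n + 1) → ℝ, v ≠ 0 ∧ ∑ i, v i = 0 ∧
      v ⬝ᵥ Dmat n (mgr (Fin (n + 1))) *ᵥ v = 0 := by
  by_contra! hne
  have hle := (isNegType_iff_Dmat n _).1 (isNegType_mgr n hfin)
  suffices ∃ p > mgr (Fin (n + 1)), IsNegType (Fin (n + 1)) p by
    obtain ⟨p, hp, hneg⟩ := this
    exact absurd (le_csSup hfin ⟨(mgr_nonneg _).trans hp.le, hneg⟩) (not_le.2 hp)
  rcases (mgr_nonneg (Fin (n + 1))).eq_or_lt with h0 | hpos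
  · refine ⟨1, by rw [← h0]; exact one_pos, (isNegType_iff_Dmat n 1).2 fun v hv => ?_⟩
    have hv0 : v = 0 := by
      by_contra hv0
      apply hne v hv0 hv
      rw [← h0, dotProduct_Dmat_zero_mulVec, hv, sq, zero_mul]
    simp [hv0]
  · have hK : IsCompact (Metric.sphere (0 : Fin (n + 1) → ℝ) 1 ∩ {v | ∑ i, v i = 0}) :=
      (isCompact_sphere 0 1).inter_right (isClosed_eq (by fun_prop) continuous_const)
    have hev : ∀ᶠ p in 𝓝 (mgr (Fin (n + 1))),
        ∀ v ∈ Metric.sphere (0 : Fin (n + 1) → ℝ) 1 ∩ {v | ∑ i, v i = 0},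
          v ⬝ᵥ Dmat n p *ᵥ v < 0 := by
      refine hK.eventually_forall_of_forall_eventually fun v hv => ?_
      have hv0 : v ≠ 0 := by
        rintro rfl
        simp at hv
      exact (continuousAt_dotProduct_Dmat_mulVec n hpos v).eventually
        (gt_mem_nhds ((hle v hv.2).lt_of_ne (hne v hv0 hv.2)))
    obtain ⟨p, hp, hgt⟩ :=
      ((hev.filter_mono nhdsWithin_le_nhds).and
        (self_mem_nhdsWithin : Set.Ioi (mgr (Fin (n + 1))) ∈ 𝓝[>] _)).exists
    refine ⟨p, hgt, (isNegType_iff_Dmat n p).2 fun v hv => ?_⟩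
    by_cases hv0 : v = 0
    · simp [hv0]
    · have hnorm : 0 < ‖v‖ := norm_pos_iff.2 hv0
      have h := hp (‖v‖⁻¹ • v) ⟨by simp [norm_smul, hnorm.ne'], by
        simp [← Finset.mul_sum, hv]⟩
      simp only [mulVec_smul, smul_dotProduct, dotProduct_smul, smul_eq_mul] at h
      rw [← mul_assoc] at h
      exact (neg_of_mul_neg_right h (by positivity)).le

theorem one_dotProduct_Dmat_mulVec_one_pos (n : ℕ) [MetricSpace (Fin (n + 1))] (p : ℝ)
    (hn : Nontrivial (Fin (n + 1))) : 0 < (1 : Fin (n + 1) → ℝ) ⬝ᵥ Dmat n p *ᵥ 1 := by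
  rw [dotProduct_Dmat_mulVec]
  obtain ⟨a, b, hab⟩ := hn
  have hpos : 0 < dist a b ^ p := Real.rpow_pos_of_pos (dist_pos.2 hab) p
  have hnonneg (i j : Fin (n + 1)) : 0 ≤ dist i j ^ p * (1 : Fin (n + 1) → ℝ) i *
      (1 : Fin (n + 1) → ℝ) j := by
    simpa using Real.rpow_nonneg dist_nonneg p
  refine Finset.sum_pos' (fun i _ => Finset.sum_nonneg fun j _ => hnonneg i j)
    ⟨a, Finset.mem_univ a, Finset.sum_pos' (fun j _ => hnonneg a j) ⟨b, Finset.mem_univ b, ?_⟩⟩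
  simpa using hpos

/-- Sánchez's dichotomy: with `℘ = mgr(X) < ∞`, exactly one of the following holds:
(1) `det (D_℘) = 0` and every `ξ ∈ ker (D_℘)` lies in the hyperplane `∑ᵢ ξᵢ = 0`; or
(2) `det (D_℘) ≠ 0` and `⟨D_℘⁻¹ 𝟙, 𝟙⟩ = 0`.
(The two alternatives are mutually exclusive since they make contradictory assertions
about `det (D_℘)`.) -/
theorem sanchez_dichotomy (n : ℕ) [MetricSpace (Fin (n + 1))]
    (hfin : BddAbove {p : ℝ | 0 ≤ p ∧ IsNegType (Fin (n + 1)) p}) :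
    ((Dmat n (mgr (Fin (n + 1)))).det = 0 ∧
        ∀ ξ : Fin (n + 1) → ℝ, Dmat n (mgr (Fin (n + 1))) *ᵥ ξ = 0 → ∑ i, ξ i = 0) ∨
      ((Dmat n (mgr (Fin (n + 1)))).det ≠ 0 ∧
        (Dmat n (mgr (Fin (n + 1))))⁻¹ *ᵥ (1 : Fin (n + 1) → ℝ) ⬝ᵥ 1 = 0) := by
  set D := Dmat n (mgr (Fin (n + 1)))
  have hsymm : D.IsSymm := Dmat_isSymm n _
  have hneg : ∀ v : Fin (n + 1) → ℝ, ∑ i, v i = 0 → v ⬝ᵥ D *ᵥ v ≤ 0 :=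
    (isNegType_iff_Dmat n _).1 (isNegType_mgr n hfin)
  obtain ⟨w, hw, hwsum, hw0⟩ := exists_dotProduct_Dmat_mgr_mulVec_eq_zero n hfin
  obtain ⟨c, hc⟩ := hsymm.exists_mulVec_eq_const hneg hwsum hw0
  by_cases hdet : D.det = 0
  · refine Or.inl ⟨hdet, fun η hη => ?_⟩
    by_contra hs
    have hn : Nontrivial (Fin (n + 1)) := by
      by_contra hn
      rw [not_nontrivial_iff_subsingleton] at hn
      refine hw (funext fun i => ?_)
      rwa [Fintype.sum_subsingleton _ i] at hwsum
    have hη' : η ᵥ* D = 0 := by rw [← mulVec_transpose, hsymm.eq, hη]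
    set t := (∑ i, (1 : Fin (n + 1) → ℝ) i) / ∑ i, η i with ht
    have h := hneg (1 - t • η) (by
      simp only [Pi.sub_apply, Pi.smul_apply, smul_eq_mul, Finset.sum_sub_distrib,
        ← Finset.mul_sum]
      rw [ht, div_mul_cancel₀ _ hs, sub_self])
    rw [mulVec_sub, mulVec_smul, hη, smul_zero, sub_zero, sub_dotProduct, smul_dotProduct,
      dotProduct_mulVec η, hη', zero_dotProduct, smul_zero, sub_zero] at h
    exact absurd h (not_le.2 (one_dotProduct_Dmat_mulVec_one_pos n _ hn))
  · refine Or.inr ⟨hdet, ?_⟩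
    have hunit : IsUnit D.det := isUnit_iff_ne_zero.2 hdet
    have hwc : w = c • D⁻¹ *ᵥ 1 := by
      rw [← mulVec_smul, ← one_mulVec w, ← nonsing_inv_mul D hunit, ← mulVec_mulVec, hc]
      congr 1
      ext
      simp
    have hc0 : c ≠ 0 := by
      rintro rfl
      exact hw (by simpa using hwc)
    rw [← dotProduct_one, hwc, smul_dotProduct, smul_eq_mul] at hwsum
    exact (mul_eq_zero.1 hwsum).resolve_left hc0
end

section
/- (Murugan's Theorem) A subset X = {x_0, x_1, ..., x_m} ⊆ (H_n, ℓ¹) of the n-dimensional Hamming cube with x_0 = 0 has mgr(X) > 1 if and only if the points x_0, x_1, ..., x_m are affinely independent (equivalently, since x_0 = 0, if and only if x_1, ..., x_m are linearly independent as vectors in ℝ^n). -/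
open BigOperators

/-- The ℓ¹ (Hamming) distance on `ℝ^n`. -/
noncomputable def ellOneDist {n : ℕ} (x y : Fin n → ℝ) : ℝ := ∑ k, |x k - y k|

/-- The finite subset `X = {x 0, …, x m}` of the Hamming cube has `p`-negative type:
for all finite collections of points of `X` and reals `ξ` summing to `0`,
`∑_{i,j} d(x_i, x_j)^p ξ_i ξ_j ≤ 0`. -/
def HasNegType {n m : ℕ} (x : Fin (m + 1) → Fin n → ℝ) (p : ℝ) : Prop :=
  ∀ (N : ℕ) (z : Fin N → Fin (m + 1)) (ξ : Fin N → ℝ), (∑ i, ξ i) = 0 →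
    ∑ i, ∑ j, ellOneDist (x (z i)) (x (z j)) ^ p * ξ i * ξ j ≤ 0

/-- The maximal generalised roundness of `X = {x 0, …, x m}`, valued in `[0, ∞]`. -/
noncomputable def mgrE {n m : ℕ} (x : Fin (m + 1) → Fin n → ℝ) : ENNReal :=
  ⨆ p ∈ {p : ℝ | 0 ≤ p ∧ HasNegType x p}, ENNReal.ofReal p

open Filter Topology MeasureTheory Set

section QuadraticForms

variable {ι : Type*} [Fintype ι]

/-- The value at `a` of the quadratic form with coefficients `K`. -/
def quadForm (K : ι → ι → ℝ) (a : ι → ℝ) : ℝ := ∑ i, ∑ j, K i j * a i * a j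

lemma posSemidef_of_iff {K : ι → ι → ℝ} :
    (Matrix.of K).PosSemidef ↔ (∀ i j, K i j = K j i) ∧ ∀ a, 0 ≤ quadForm K a := by
  rw [Matrix.posSemidef_iff_dotProduct_mulVec]
  refine and_congr ⟨fun h i j => ?_, fun h => ?_⟩ (forall_congr' fun a => ?_)
  · simpa using h.apply j i
  · ext i j
    simpa using h j i
  · rw [quadForm]
    refine Eq.to_iff (congrArg _ ?_)
    simp only [dotProduct, Matrix.mulVec, Finset.mul_sum, Matrix.of_apply, star_trivial]
    exact Finset.sum_congr rfl fun i _ => Finset.sum_congr rfl fun j _ => by ring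

lemma posSemidef_of_pow {K : ι → ι → ℝ} (hK : (Matrix.of K).PosSemidef) (k : ℕ) :
    (Matrix.of fun i j => K i j ^ k).PosSemidef := by
  induction k with
  | zero =>
    refine posSemidef_of_iff.2 ⟨by simp, fun a => ?_⟩
    have : quadForm (fun i j => K i j ^ 0) a = (∑ i, a i) * ∑ j, a j := by
      rw [Finset.sum_mul_sum]
      simp [quadForm]
    rw [this]
    exact mul_self_nonneg _
  | succ k ih =>
    have := ih.hadamard hK
    exact this

lemma abs_lt_one_of_posSemidef {K : ι → ι → ℝ} (hK : (Matrix.of K).PosSemidef)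
    (hdiag : ∀ i, K i i < 1) (i j : ι) : |K i j| < 1 := by
  classical
  obtain ⟨hsymm, hpos⟩ := posSemidef_of_iff.1 hK
  have key : ∀ c : ℝ, quadForm K (Pi.single i 1 + c • Pi.single j 1) =
      K i i + c * K i j + c * K j i + c ^ 2 * K j j := by
    intro c
    simp [quadForm, mul_add, add_mul, Finset.sum_add_distrib, Pi.single_apply]
    ring
  have h1 := hpos (Pi.single i 1 + (1 : ℝ) • Pi.single j 1)
  have h2 := hpos (Pi.single i 1 + (-1 : ℝ) • Pi.single j 1)
  rw [key] at h1 h2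
  have := hdiag i
  have := hdiag j
  have := hsymm i j
  rw [abs_lt]
  constructor <;> linarith

lemma quadForm_one_sub_inv_nonneg {K : ι → ι → ℝ} (hK : (Matrix.of K).PosSemidef)
    (hdiag : ∀ i, K i i < 1) (a : ι → ℝ) : 0 ≤ quadForm (fun i j => (1 - K i j)⁻¹) a := by
  have : HasSum (fun k => quadForm (fun i j => K i j ^ k) a)
      (quadForm (fun i j => (1 - K i j)⁻¹) a) :=
    hasSum_sum fun i _ => hasSum_sum fun j _ =>
      ((hasSum_geometric_of_abs_lt_one (abs_lt_one_of_posSemidef hK hdiag i j)).mul_right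
        (a i)).mul_right (a j)
  exact this.nonneg fun k => (posSemidef_of_iff.1 (posSemidef_of_pow hK k)).2 a

/-- Schoenberg's Gram kernel of a conditionally negative definite kernel. -/
lemma gram_nonneg {D : ι → ι → ℝ} (hsymm : ∀ i j, D i j = D j i) (hdiag : ∀ i, D i i = 0)
    (hneg : ∀ a : ι → ℝ, ∑ i, a i = 0 → quadForm D a ≤ 0) (o : ι) (a : ι → ℝ) :
    0 ≤ quadForm (fun i j => D i o + D o j - D i j) a := by
  classical
  set s := ∑ i, a i with hs
  have h := hneg (a - s • Pi.single o 1) (by simp [← Finset.mul_sum, ← hs])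
  have e1 : quadForm D (a - s • Pi.single o 1) = quadForm D a - 2 * s * ∑ i, D i o * a i := by
    simp only [quadForm, Pi.sub_apply, Pi.smul_apply, smul_eq_mul, mul_sub, sub_mul,
      Finset.sum_sub_distrib, Pi.single_apply, mul_ite, ite_mul, mul_one, mul_zero, zero_mul,
      Finset.sum_ite_eq', Finset.mem_univ, if_true, Finset.sum_ite_irrel, Finset.sum_const_zero,
      hdiag, hsymm o]
    rw [Finset.mul_sum, ← Finset.sum_sub_distrib, ← Finset.sum_sub_distrib, sub_zero,
      ← Finset.sum_sub_distrib]
    refine Finset.sum_congr rfl fun i _ => ?_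
    ring
  have e2 : quadForm (fun i j => D i o + D o j - D i j) a =
      2 * s * (∑ i, D i o * a i) - quadForm D a := by
    have h1 : ∑ i, ∑ j, D i o * a i * a j = (∑ i, D i o * a i) * s := by
      rw [hs, Finset.sum_mul_sum]
    have h2 : ∑ i, ∑ j, D o j * a i * a j = s * (∑ i, D i o * a i) := by
      rw [hs, Finset.sum_mul_sum]
      refine Finset.sum_congr rfl fun i _ => Finset.sum_congr rfl fun j _ => ?_
      rw [hsymm o j]
      ring
    simp only [quadForm, add_mul, sub_mul, Finset.sum_add_distrib, Finset.sum_sub_distrib, h1, h2]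
    ring
  linarith

lemma quadForm_add_inv_nonneg {D : ι → ι → ℝ} (hsymm : ∀ i j, D i j = D j i)
    (hdiag : ∀ i, D i i = 0) (hnonneg : ∀ i j, 0 ≤ D i j)
    (hneg : ∀ a : ι → ℝ, ∑ i, a i = 0 → quadForm D a ≤ 0) {t : ℝ} (ht : 0 < t) (a : ι → ℝ) :
    0 ≤ quadForm (fun i j => (t + D i j)⁻¹) a := by
  cases isEmpty_or_nonempty ι
  · simp [quadForm]
  obtain ⟨o⟩ := ‹Nonempty ι›
  set r : ι → ℝ := fun i => t + D i o with hr
  have hrpos : ∀ i, 0 < r i := fun i => by have := hnonneg i o; positivity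
  set K : ι → ι → ℝ := fun i j => 1 - t * (t + D i j) / (r i * r j) with hKdef
  have hK : (Matrix.of K).PosSemidef := by
    refine posSemidef_of_iff.2 ⟨fun i j => ?_, fun b => ?_⟩
    · simp only [hKdef, hsymm i j, mul_comm (r i)]
    · have : quadForm K b = t * quadForm (fun i j => D i o + D o j - D i j) (fun i => b i / r i)
          + (∑ i, D i o * (b i / r i)) * ∑ j, D j o * (b j / r j) := by
        rw [Finset.sum_mul_sum]
        simp only [quadForm, Finset.mul_sum, ← Finset.sum_add_distrib]
        refine Finset.sum_congr rfl fun i _ => Finset.sum_congr rfl fun j _ => ?_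
        have h1 := (hrpos i).ne'
        have h2 := (hrpos j).ne'
        simp only [hKdef, hsymm o j]
        field_simp
        simp only [hr]
        ring
      rw [this]
      have := gram_nonneg hsymm hdiag hneg o (fun i => b i / r i)
      have := mul_self_nonneg (∑ i, D i o * (b i / r i))
      positivity
  have hK1 : ∀ i, K i i < 1 := fun i => by
    have := hrpos i
    have : 0 < t * (t + D i i) / (r i * r i) := by rw [hdiag]; positivity
    simp only [hKdef]
    linarith
  have := quadForm_one_sub_inv_nonneg hK hK1 (fun i => a i / r i)
  have e : quadForm (fun i j => (t + D i j)⁻¹) a =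
      t * quadForm (fun i j => (1 - K i j)⁻¹) (fun i => a i / r i) := by
    simp only [quadForm, Finset.mul_sum]
    refine Finset.sum_congr rfl fun i _ => Finset.sum_congr rfl fun j _ => ?_
    have h1 := (hrpos i).ne'
    have h2 := (hrpos j).ne'
    have h3 : t + D i j ≠ 0 := by have := hnonneg i j; positivity
    simp only [hKdef, sub_sub_cancel]
    field_simp
  rw [e]
  positivity

/-- Powers in `(0, 1)` of a conditionally negative definite kernel that vanishes only on the
diagonal are strictly conditionally negative definite. -/
lemma quadForm_rpow_neg {D : ι → ι → ℝ} (hsymm : ∀ i j, D i j = D j i)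
    (hdiag : ∀ i, D i i = 0) (hpos : ∀ i j, i ≠ j → 0 < D i j)
    (hneg : ∀ a : ι → ℝ, ∑ i, a i = 0 → quadForm D a ≤ 0) {q : ℝ} (hq : q ∈ Ioo (0 : ℝ) 1)
    {a : ι → ℝ} (ha : ∑ i, a i = 0) (hne : a ≠ 0) :
    quadForm (fun i j => D i j ^ q) a < 0 := by
  classical
  have hnonneg : ∀ i j, 0 ≤ D i j := fun i j => by
    rcases eq_or_ne i j with rfl | h
    · exact (hdiag i).ge
    · exact (hpos i j h).le
  set g : ℝ → ℝ := fun t => quadForm (fun i j => (t + D i j)⁻¹) a with hg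
  set h : ℝ → ℝ := fun t => - quadForm (fun i j => Real.rpowIntegrand₀₁ q t (D i j)) a with hh
  have hint : IntegrableOn h (Ioi 0) :=
    (integrable_finsetSum _ fun i _ => integrable_finsetSum _ fun j _ =>
      ((Real.integrableOn_rpowIntegrand₀₁_Ioi hq (hnonneg i j)).mul_const _).mul_const _).neg
  have hval : quadForm (fun i j => D i j ^ q) a =
      -((∫ t in Ioi 0, Real.rpowIntegrand₀₁ q t 1)⁻¹ * ∫ t in Ioi 0, h t) := by
    simp only [hh, integral_neg, quadForm]
    rw [integral_finsetSum _ fun i _ => integrable_finsetSum _ fun j _ =>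
      ((Real.integrableOn_rpowIntegrand₀₁_Ioi hq (hnonneg i j)).mul_const _).mul_const _]
    rw [mul_neg, neg_neg, Finset.mul_sum]
    refine Finset.sum_congr rfl fun i _ => ?_
    rw [integral_finsetSum _ fun j _ =>
      ((Real.integrableOn_rpowIntegrand₀₁_Ioi hq (hnonneg i j)).mul_const _).mul_const _,
      Finset.mul_sum]
    refine Finset.sum_congr rfl fun j _ => ?_
    rw [Real.rpow_eq_const_mul_integral hq (hnonneg i j), integral_mul_const, integral_mul_const]
    ring
  have hhg : ∀ t, 0 < t → h t = t ^ q * g t := by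
    intro t _
    have h0 : ∑ i, ∑ j, t ^ q * t⁻¹ * a i * a j = 0 := by
      simp [← Finset.mul_sum, ha]
    have : h t = t ^ q * g t - ∑ i, ∑ j, t ^ q * t⁻¹ * a i * a j := by
      simp only [hh, hg, quadForm, Finset.mul_sum, ← Finset.sum_sub_distrib,
        ← Finset.sum_neg_distrib, Real.rpowIntegrand₀₁]
      exact Finset.sum_congr rfl fun i _ => Finset.sum_congr rfl fun j _ => by ring
    rw [this, h0, sub_zero]
  have hlim : Tendsto (fun t => t * g t) (𝓝[>] 0) (𝓝 (∑ i, a i * a i)) := by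
    have e : ∑ i, a i * a i = quadForm (fun i j => if i = j then 1 else 0) a := by
      simp [quadForm]
    rw [e]
    simp only [hg, quadForm, Finset.mul_sum]
    refine tendsto_finsetSum _ fun i _ => tendsto_finsetSum _ fun j _ => ?_
    simp only [← mul_assoc]
    refine Tendsto.mul_const _ (Tendsto.mul_const _ ?_)
    rcases eq_or_ne i j with rfl | hij
    · rw [if_pos rfl]
      refine tendsto_const_nhds.congr' ?_
      filter_upwards [self_mem_nhdsWithin] with t ht
      rw [hdiag, add_zero, mul_inv_cancel₀ (ne_of_gt ht)]
    · rw [if_neg hij]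
      have : ContinuousAt (fun t : ℝ => t * (t + D i j)⁻¹) 0 :=
        continuousAt_id.mul ((continuousAt_id.add continuousAt_const).inv₀
          (by simpa using (hpos i j hij).ne'))
      simpa using this.tendsto.mono_left nhdsWithin_le_nhds
  have hapos : 0 < ∑ i, a i * a i := by
    obtain ⟨i, hi⟩ := Function.ne_iff.1 hne
    exact Finset.sum_pos' (fun i _ => mul_self_nonneg _) ⟨i, Finset.mem_univ _, mul_self_pos.2 hi⟩
  have hgnonneg : ∀ t, 0 < t → 0 ≤ g t := fun t ht =>
    quadForm_add_inv_nonneg hsymm hdiag hnonneg hneg ht a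
  obtain ⟨ε, hε, hsub⟩ := mem_nhdsGT_iff_exists_Ioo_subset.1 (hlim.eventually (lt_mem_nhds hapos))
  have hI : 0 < ∫ t in Ioi 0, h t := by
    rw [setIntegral_pos_iff_support_of_nonneg_ae _ hint]
    · refine lt_of_lt_of_le ?_ (measure_mono (s := Ioo 0 ε) fun t ht => ⟨?_, ht.1⟩)
      · simpa using hε
      · have h1 : 0 < t * g t := hsub ht
        have h2 := Real.rpow_pos_of_pos ht.1 q
        rw [Function.mem_support, hhg t ht.1]
        exact mul_ne_zero h2.ne' (right_ne_zero_of_mul h1.ne')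
    · refine ae_restrict_of_forall_mem measurableSet_Ioi fun t ht => ?_
      have h1 := hgnonneg t ht
      have h2 := Real.rpow_pos_of_pos ht q
      rw [hhg t ht]
      exact mul_nonneg h2.le h1
  rw [hval, neg_lt_zero]
  exact mul_pos (inv_pos.2 (Real.integral_rpowIntegrand₀₁_one_pos hq)) hI

/-- Strict conditional negative definiteness at exponent `1` persists at nearby exponents. -/
lemma eventually_quadForm_rpow_nonpos {D : ι → ι → ℝ}
    (hneg : ∀ a : ι → ℝ, ∑ i, a i = 0 → a ≠ 0 → quadForm D a < 0) :
    ∀ᶠ q : ℝ in 𝓝 1, ∀ a : ι → ℝ, ∑ i, a i = 0 → quadForm (fun i j => D i j ^ q) a ≤ 0 := by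
  set S : Set (ι → ℝ) := Metric.sphere 0 1 ∩ {a | ∑ i, a i = 0} with hS
  have hScomp : IsCompact S := (isCompact_sphere _ _).inter_right
    (isClosed_eq (continuous_finsetSum _ fun i _ => continuous_apply i) continuous_const)
  have hev : ∀ᶠ q : ℝ in 𝓝 1, ∀ a ∈ S, quadForm (fun i j => D i j ^ q) a < 0 := by
    refine hScomp.eventually_forall_of_forall_eventually fun a ha => ?_
    have hcont : ContinuousAt
        (fun z : ℝ × (ι → ℝ) => quadForm (fun i j => D i j ^ z.1) z.2) (1, a) := by
      refine tendsto_finsetSum _ fun i _ => tendsto_finsetSum _ fun j _ => ?_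
      have h1 : ContinuousAt (fun z : ℝ × (ι → ℝ) => D i j ^ z.1) (1, a) :=
        ContinuousAt.comp (f := Prod.fst) (g := fun q : ℝ => D i j ^ q)
          (Real.continuousAt_const_rpow' one_ne_zero) continuousAt_fst
      have h2 : ∀ k, ContinuousAt (fun z : ℝ × (ι → ℝ) => z.2 k) (1, a) := fun k => by fun_prop
      exact (h1.mul (h2 i)).mul (h2 j)
    refine hcont.eventually (gt_mem_nhds ?_)
    simp only [Real.rpow_one]
    refine hneg a ha.2 fun h0 => ?_
    simpa [h0] using ha.1
  filter_upwards [hev] with q hq a ha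
  rcases eq_or_ne a 0 with rfl | hne
  · simp [quadForm]
  have hn : 0 < ‖a‖ := norm_pos_iff.2 hne
  have h1 := hq (‖a‖⁻¹ • a) ⟨by simp [norm_smul, hn.ne'], by simp [← Finset.mul_sum, ha]⟩
  have h2 : quadForm (fun i j => D i j ^ q) a =
      ‖a‖ ^ 2 * quadForm (fun i j => D i j ^ q) (‖a‖⁻¹ • a) := by
    simp only [quadForm, Finset.mul_sum, Pi.smul_apply, smul_eq_mul]
    refine Finset.sum_congr rfl fun i _ => Finset.sum_congr rfl fun j _ => ?_
    field_simp
  rw [h2]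
  exact (mul_neg_of_pos_of_neg (by positivity) h1).le

end QuadraticForms

section HammingCube

variable {n m : ℕ} {x : Fin (m + 1) → Fin n → ℝ}

lemma ellOneDist_comm (u v : Fin n → ℝ) : ellOneDist u v = ellOneDist v u :=
  Finset.sum_congr rfl fun _ _ => abs_sub_comm _ _

lemma ellOneDist_self (u : Fin n → ℝ) : ellOneDist u u = 0 := by simp [ellOneDist]

lemma ellOneDist_nonneg (u v : Fin n → ℝ) : 0 ≤ ellOneDist u v :=
  Finset.sum_nonneg fun _ _ => abs_nonneg _

lemma ellOneDist_pos {u v : Fin n → ℝ} (h : u ≠ v) : 0 < ellOneDist u v := by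
  obtain ⟨k, hk⟩ := Function.ne_iff.1 h
  exact Finset.sum_pos' (fun _ _ => abs_nonneg _)
    ⟨k, Finset.mem_univ _, abs_pos.2 (sub_ne_zero.2 hk)⟩

lemma hasNegType_iff_quadForm {p : ℝ} :
    HasNegType x p ↔ ∀ a : Fin (m + 1) → ℝ, ∑ i, a i = 0 →
      quadForm (fun i j => ellOneDist (x i) (x j) ^ p) a ≤ 0 := by
  refine ⟨fun h a ha => h (m + 1) id a ha, fun h N z ξ hξ => ?_⟩
  set w : Fin (m + 1) → ℝ := fun k => ∑ i with z i = k, ξ i with hw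
  have key : ∀ f : Fin (m + 1) → ℝ, ∑ i, f (z i) * ξ i = ∑ k, f k * w k := fun f => by
    rw [← Finset.sum_fiberwise _ z]
    refine Finset.sum_congr rfl fun k _ => ?_
    rw [hw, Finset.mul_sum]
    refine Finset.sum_congr rfl fun i hi => ?_
    rw [(Finset.mem_filter.1 hi).2]
  have h1 := h w (by simpa [hξ] using (key 1).symm)
  refine le_of_eq_of_le ?_ h1
  have e : ∀ k, ∑ j, ellOneDist (x k) (x (z j)) ^ p * ξ j =
      ∑ j, ellOneDist (x k) (x j) ^ p * w j := fun k =>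
    key fun j => ellOneDist (x k) (x j) ^ p
  calc ∑ i, ∑ j, ellOneDist (x (z i)) (x (z j)) ^ p * ξ i * ξ j
      = ∑ i, (∑ j, ellOneDist (x (z i)) (x j) ^ p * w j) * ξ i := by
        simp only [← e, Finset.sum_mul, mul_right_comm]
    _ = ∑ i, (∑ j, ellOneDist (x i) (x j) ^ p * w j) * w i :=
        key fun k => ∑ j, ellOneDist (x k) (x j) ^ p * w j
    _ = quadForm (fun i j => ellOneDist (x i) (x j) ^ p) w := by
        simp only [quadForm, Finset.sum_mul, mul_right_comm]

lemma one_lt_mgrE_iff : 1 < mgrE x ↔ ∃ p, 1 < p ∧ HasNegType x p := by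
  simp only [mgrE, lt_iSup_iff, Set.mem_ofPred_eq, ENNReal.one_lt_ofReal]
  exact ⟨fun ⟨p, ⟨_, h⟩, hp⟩ => ⟨p, hp, h⟩, fun ⟨p, hp, h⟩ => ⟨p, ⟨by linarith, h⟩, hp⟩⟩

lemma quadForm_ellOneDist (hcube : ∀ i k, x i k = 0 ∨ x i k = 1) {a : Fin (m + 1) → ℝ}
    (ha : ∑ i, a i = 0) :
    quadForm (fun i j => ellOneDist (x i) (x j)) a = -2 * ∑ k, ((∑ i, a i • x i) k) ^ 2 := by
  have habs : ∀ i j k, |x i k - x j k| = x i k + x j k - 2 * x i k * x j k := fun i j k => by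
    rcases hcube i k with h | h <;> rcases hcube j k with hj | hj <;> norm_num [h, hj]
  have hk : ∀ k, ∑ i, ∑ j, |x i k - x j k| * a i * a j = -2 * ((∑ i, a i • x i) k) ^ 2 := by
    intro k
    have e : ∀ i j, |x i k - x j k| * a i * a j =
        (a i * x i k) * a j + a i * (a j * x j k) - 2 * ((a i * x i k) * (a j * x j k)) :=
      fun i j => by rw [habs]; ring
    simp only [e, Finset.sum_add_distrib, Finset.sum_sub_distrib, ← Finset.mul_sum,
      ha, Finset.sum_apply, Pi.smul_apply, smul_eq_mul, ← Finset.sum_mul]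
    ring
  simp only [quadForm, ellOneDist, Finset.sum_mul]
  rw [Finset.mul_sum, ← Finset.sum_congr rfl fun k _ => hk k]
  simp only [Finset.sum_comm (s := (Finset.univ : Finset (Fin n)))
    (t := (Finset.univ : Finset (Fin (m + 1))))]

lemma one_lt_mgrE_iff_forall (hcube : ∀ i k, x i k = 0 ∨ x i k = 1)
    (hinj : Function.Injective x) :
    1 < mgrE x ↔ ∀ a : Fin (m + 1) → ℝ, ∑ i, a i = 0 → ∑ i, a i • x i = 0 → a = 0 := by
  rw [one_lt_mgrE_iff]
  constructor
  · rintro ⟨p, hp, h⟩ a ha hax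
    by_contra hne
    have hp0 : p ≠ 0 := by positivity
    have := quadForm_rpow_neg (D := fun i j => ellOneDist (x i) (x j) ^ p) (q := p⁻¹)
      (fun i j => by rw [ellOneDist_comm])
      (fun i => by rw [ellOneDist_self, Real.zero_rpow hp0])
      (fun i j hij => Real.rpow_pos_of_pos (ellOneDist_pos (hinj.ne hij)) p)
      (hasNegType_iff_quadForm.1 h)
      ⟨by positivity, inv_lt_one_of_one_lt₀ hp⟩ ha hne
    simp only [Real.rpow_rpow_inv (ellOneDist_nonneg _ _) hp0] at this
    rw [quadForm_ellOneDist hcube ha, hax] at this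
    simp at this
  · intro h
    have hev := eventually_quadForm_rpow_nonpos (D := fun i j => ellOneDist (x i) (x j))
      fun a ha hne => by
        rw [quadForm_ellOneDist hcube ha]
        obtain ⟨k, hk⟩ := Function.ne_iff.1 (mt (h a ha) hne)
        have : 0 < ∑ k, ((∑ i, a i • x i) k) ^ 2 :=
          Finset.sum_pos' (fun _ _ => sq_nonneg _) ⟨k, Finset.mem_univ _, sq_pos_of_ne_zero hk⟩
        linarith
    obtain ⟨p, hp, hp1⟩ := ((hev.filter_mono nhdsWithin_le_nhds).and
      (self_mem_nhdsWithin : Ioi (1 : ℝ) ∈ 𝓝[>] 1)).exists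
    exact ⟨p, hp1, hasNegType_iff_quadForm.2 hp⟩

end HammingCube

lemma affineIndependent_iff_forall_sum_smul {ι V : Type*} [Fintype ι] [AddCommGroup V] [Module ℝ V]
    {x : ι → V} : AffineIndependent ℝ x ↔
      ∀ a : ι → ℝ, ∑ i, a i = 0 → ∑ i, a i • x i = 0 → a = 0 := by
  rw [affineIndependent_iff_of_fintype]
  refine forall_congr' fun a => forall_congr' fun ha => ?_
  rw [Finset.univ.weightedVSub_eq_linear_combination ha, funext_iff]
  rfl

lemma linearIndependent_succ_iff_forall_sum_smul {m : ℕ} {V : Type*} [AddCommGroup V] [Module ℝ V]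
    {x : Fin (m + 1) → V} (h0 : x 0 = 0) :
    LinearIndependent ℝ (fun i : Fin m => x i.succ) ↔
      ∀ a : Fin (m + 1) → ℝ, ∑ i, a i = 0 → ∑ i, a i • x i = 0 → a = 0 := by
  rw [Fintype.linearIndependent_iff]
  constructor
  · intro h a ha hax
    rw [Fin.sum_univ_succ, h0, smul_zero, zero_add] at hax
    have hs := h _ hax
    rw [Fin.sum_univ_succ] at ha
    simp only [hs, Finset.sum_const_zero, add_zero] at ha
    exact funext fun i => Fin.cases ha hs i
  · intro h g hg i
    have := h (Fin.cons (-∑ i, g i) g) (by simp [Fin.sum_univ_succ])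
      (by simpa [Fin.sum_univ_succ, h0] using hg)
    simpa using congrFun this i.succ

/-- Murugan's theorem: a subset `X = {x_0, x_1, …, x_m}` of the Hamming cube
`H_n = ({0,1}^n, ℓ¹)` with `x_0 = 0` has `mgr(X) > 1` if and only if the points are
affinely independent; equivalently (since `x_0 = 0`), if and only if `x_1, …, x_m`
are linearly independent as vectors in `ℝ^n`. -/
theorem murugan (n m : ℕ) (x : Fin (m + 1) → Fin n → ℝ)
    (hcube : ∀ i k, x i k = 0 ∨ x i k = 1) (h0 : x 0 = 0)
    (hinj : Function.Injective x) :
    (1 < mgrE x ↔ AffineIndependent ℝ x) ∧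
      (1 < mgrE x ↔ LinearIndependent ℝ (fun i : Fin m => x i.succ)) := by
  rw [affineIndependent_iff_forall_sum_smul, linearIndependent_succ_iff_forall_sum_smul h0]
  exact ⟨one_lt_mgrE_iff_forall hcube hinj, one_lt_mgrE_iff_forall hcube hinj⟩
end

section
/- Let X = {x_0, x_1, ..., x_m} ⊆ (H_n, ℓ¹) be a subset of the n-dimensional Hamming cube with x_0 = 0. Then det(M_1) ≠ 0 if and only if x_1, ..., x_m are linearly independent as vectors in ℝ^n, where M_1 is the Cayley–Menger matrix of X at exponent p = 1. -/
open Matrix BigOperators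

theorem ellOneDist_eq_of_cube {n : ℕ} {x y : Fin n → ℝ} (hx : ∀ k, x k = 0 ∨ x k = 1)
    (hy : ∀ k, y k = 0 ∨ y k = 1) : ellOneDist x y = x ⬝ᵥ x + y ⬝ᵥ y - 2 * (x ⬝ᵥ y) := by
  simp only [ellOneDist, dotProduct, Finset.mul_sum, ← Finset.sum_add_distrib,
    ← Finset.sum_sub_distrib]
  refine Finset.sum_congr rfl fun k _ => ?_
  rcases hx k with h | h <;> rcases hy k with h' | h' <;> norm_num [h, h']

/-- A vector lies in the kernel of a bordered matrix `[[0, 𝟙ᵀ], [𝟙, D]]` iff its last block `c`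
sums to zero and `D c` is the constant vector given by minus its first entry. -/
theorem bordered_mulVec_eq_zero_iff {ι : Type*} [Fintype ι] (D : Matrix ι ι ℝ)
    (v : Fin 1 ⊕ ι → ℝ) :
    Matrix.fromBlocks (0 : Matrix (Fin 1) (Fin 1) ℝ)
        (Matrix.of fun _ _ => 1) (Matrix.of fun _ _ => 1) D *ᵥ v = 0 ↔
      ∑ j, v (Sum.inr j) = 0 ∧ ∀ i, v (Sum.inl 0) + ∑ j, D i j * v (Sum.inr j) = 0 := by
  rw [funext_iff, Sum.forall]
  simp [Matrix.mulVec, dotProduct]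

/-- The kernel of the Cayley–Menger matrix of a subset of the cube containing the origin. -/
theorem cayleyMenger_mulVec_eq_zero_iff {n m : ℕ} {x : Fin (m + 1) → Fin n → ℝ}
    (hcube : ∀ i k, x i k = 0 ∨ x i k = 1) (h0 : x 0 = 0) (v : Fin 1 ⊕ Fin (m + 1) → ℝ) :
    Matrix.fromBlocks (0 : Matrix (Fin 1) (Fin 1) ℝ)
        (Matrix.of fun _ _ => 1) (Matrix.of fun _ _ => 1)
        (Matrix.of fun i j : Fin (m + 1) => ellOneDist (x i) (x j)) *ᵥ v = 0 ↔
      ∑ j, v (Sum.inr j) = 0 ∧ v (Sum.inl 0) + ∑ j, v (Sum.inr j) * (x j ⬝ᵥ x j) = 0 ∧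
        ∑ j, v (Sum.inr j) • x j = 0 := by
  rw [bordered_mulVec_eq_zero_iff]
  refine and_congr_right fun hsum => ?_
  have key (i : Fin (m + 1)) :
      ∑ j, (Matrix.of fun i j => ellOneDist (x i) (x j)) i j * v (Sum.inr j) =
        ∑ j, v (Sum.inr j) * (x j ⬝ᵥ x j) - 2 * (x i ⬝ᵥ ∑ j, v (Sum.inr j) • x j) := by
    have hi : ∑ j, v (Sum.inr j) * (x i ⬝ᵥ x i) = 0 := by rw [← Finset.sum_mul, hsum, zero_mul]
    rw [← add_zero (∑ j, v (Sum.inr j) * (x j ⬝ᵥ x j)), ← hi, dotProduct_sum, Finset.mul_sum,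
      ← Finset.sum_add_distrib, ← Finset.sum_sub_distrib]
    refine Finset.sum_congr rfl fun j _ => ?_
    rw [Matrix.of_apply, ellOneDist_eq_of_cube (hcube i) (hcube j), dotProduct_smul, smul_eq_mul]
    ring
  simp only [key]
  constructor
  · intro h
    have hs := h 0
    rw [h0, zero_dotProduct, mul_zero, sub_zero] at hs
    refine ⟨hs, ?_⟩
    have horth (i : Fin (m + 1)) : x i ⬝ᵥ ∑ j, v (Sum.inr j) • x j = 0 := by
      linarith [h i]
    rw [← dotProduct_self_eq_zero]
    nth_rewrite 1 [sum_dotProduct]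
    exact Finset.sum_eq_zero fun i _ => by rw [smul_dotProduct, horth, smul_zero]
  · rintro ⟨hs, hw⟩ i
    rw [hw, dotProduct_zero, mul_zero, sub_zero, hs]

/-- For a subset `X = {x_0, x_1, …, x_m}` of the Hamming cube `H_n = ({0,1}^n, ℓ¹)`
with `x_0 = 0` and Cayley–Menger matrix `M_1 = [[0, 𝟙ᵀ], [𝟙, D_1]]` at exponent
`p = 1`: `det (M_1) ≠ 0` if and only if `x_1, …, x_m` are linearly independent
as vectors in `ℝ^n`. -/
theorem det_cayleyMenger_ne_zero_iff_linearIndependent (n m : ℕ)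
    (x : Fin (m + 1) → Fin n → ℝ)
    (hcube : ∀ i k, x i k = 0 ∨ x i k = 1) (h0 : x 0 = 0)
    (hinj : Function.Injective x) :
    (Matrix.fromBlocks (0 : Matrix (Fin 1) (Fin 1) ℝ)
        (Matrix.of fun _ _ => 1) (Matrix.of fun _ _ => 1)
        (Matrix.of fun i j : Fin (m + 1) => ellOneDist (x i) (x j))).det ≠ 0 ↔
      LinearIndependent ℝ (fun i : Fin m => x i.succ) := by
  rw [Ne, ← Matrix.exists_mulVec_eq_zero_iff, Fintype.linearIndependent_iff]
  simp only [cayleyMenger_mulVec_eq_zero_iff hcube h0, Fin.sum_univ_succ, h0, smul_zero, zero_add]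
  constructor
  · intro h g hg i
    by_contra hgi
    refine h ⟨Sum.elim (fun _ => -∑ j, g j * (x j.succ ⬝ᵥ x j.succ))
      (Fin.cons (-∑ j, g j) g), fun hv => hgi ?_, ?_, ?_, ?_⟩
    · simpa using congrFun hv (Sum.inr i.succ)
    · simp
    · simp
    · simpa using hg
  · rintro h ⟨v, hv, hsum, hs, hw⟩
    have hc := h _ hw
    simp only [hc, Finset.sum_const_zero, add_zero, zero_mul, dotProduct_zero, mul_zero]
      at hsum hs
    refine hv (funext ?_)
    rintro (i | i)
    · rw [Subsingleton.elim i 0]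
      exact hs
    · exact Fin.cases hsum hc i
end

section
/- The set of p ≥ 0 for which a metric space (X,d) has p-negative type is an interval containing 0: if (X,d) has p-negative type and 0 ≤ q ≤ p, then (X,d) has q-negative type. -/
open BigOperators

namespace Matrix

variable {ι : Type*} [Fintype ι]

/-- A real matrix is positive semidefinite iff it is symmetric with nonnegative quadratic form,
the form being written as a double sum. -/
theorem posSemidef_iff_sum_nonneg {A : Matrix ι ι ℝ} :
    A.PosSemidef ↔ (∀ i j, A i j = A j i) ∧ ∀ x : ι → ℝ, 0 ≤ ∑ i, ∑ j, A i j * x i * x j := by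
  have key (x : ι → ℝ) : star x ⬝ᵥ (A *ᵥ x) = ∑ i, ∑ j, A i j * x i * x j := by
    simp only [dotProduct, mulVec, Finset.mul_sum, Pi.star_apply, star_trivial]
    exact Finset.sum_congr rfl fun i _ => Finset.sum_congr rfl fun j _ => by ring
  rw [posSemidef_iff_dotProduct_mulVec]
  simp only [key]
  refine and_congr_left fun _ => ⟨fun h i j => ?_, fun h => ?_⟩
  · simpa using h.apply j i
  · exact IsHermitian.ext fun i j => by simpa using h j i

/-- Entrywise powers of a positive semidefinite real matrix are positive semidefinite. -/
theorem PosSemidef.map_pow_s12 {A : Matrix ι ι ℝ} (hA : A.PosSemidef) (n : ℕ) :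
    (A.map (· ^ n)).PosSemidef := by
  induction n with
  | zero =>
    refine posSemidef_iff_sum_nonneg.2 ⟨by simp, fun x => ?_⟩
    simp only [map_apply, pow_zero, one_mul, ← Finset.sum_mul_sum]
    exact mul_self_nonneg _
  | succ n ih =>
    have h : A.map (· ^ (n + 1)) = (A.map (· ^ n)).hadamard A := by
      ext i j
      simp [pow_succ]
    rw [h]
    exact ih.hadamard hA

/-- The entrywise exponential of a positive semidefinite real matrix is positive semidefinite. -/
theorem PosSemidef.map_exp_s12 {A : Matrix ι ι ℝ} (hA : A.PosSemidef) :
    (A.map Real.exp).PosSemidef := by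
  refine posSemidef_iff_sum_nonneg.2 ⟨fun i j => ?_, fun x => ?_⟩
  · simp [(posSemidef_iff_sum_nonneg.1 hA).1 i j]
  have hsum : HasSum (fun n : ℕ => ∑ i, ∑ j, A i j ^ n / n.factorial * x i * x j)
      (∑ i, ∑ j, Real.exp (A i j) * x i * x j) := by
    refine hasSum_sum fun i _ => hasSum_sum fun j _ => ?_
    have h := NormedSpace.expSeries_div_hasSum_exp (A i j)
    rw [← Real.exp_eq_exp_ℝ] at h
    exact (h.mul_right _).mul_right _
  refine hsum.nonneg fun n => ?_
  have h := (posSemidef_iff_sum_nonneg.1 (hA.map_pow_s12 n)).2 x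
  have heq : ∑ i, ∑ j, A i j ^ n / n.factorial * x i * x j
      = (∑ i, ∑ j, A.map (· ^ n) i j * x i * x j) / n.factorial := by
    simp only [Finset.sum_div, map_apply]
    exact Finset.sum_congr rfl fun i _ => Finset.sum_congr rfl fun j _ => by ring
  rw [heq]
  positivity

end Matrix

section ConditionallyNegative

variable {ι : Type*} [Fintype ι] {K : ι → ι → ℝ}

/-- If `K` is a symmetric, conditionally negative semidefinite kernel, then
`K i o + K j o - K i j - K o o` is positive semidefinite for every base point `o`. -/
theorem posSemidef_of_condNeg (hsymm : ∀ i j, K i j = K j i)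
    (hneg : ∀ ξ : ι → ℝ, ∑ i, ξ i = 0 → ∑ i, ∑ j, K i j * ξ i * ξ j ≤ 0) (o : ι) :
    (Matrix.of fun i j => K i o + K j o - K i j - K o o).PosSemidef := by
  classical
  refine Matrix.posSemidef_iff_sum_nonneg.2 ⟨fun i j => ?_, fun x => ?_⟩
  · simp only [Matrix.of_apply, hsymm i j]
    ring
  set S := ∑ i, x i with hS
  have h := hneg (fun i => x i - if i = o then S else 0) (by simp [hS])
  have h1 : ∑ i, ∑ j, K i j * (x i - if i = o then S else 0) * (x j - if j = o then S else 0)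
      = ∑ i, ∑ j, K i j * x i * x j - 2 * S * ∑ i, K i o * x i + S ^ 2 * K o o := by
    have h2 : ∑ j, K o j * x j = ∑ i, K i o * x i :=
      Finset.sum_congr rfl fun j _ => by rw [hsymm o j]
    have h3 (i : ι) : ∑ j, K i j * (x i - if i = o then S else 0) * (x j - if j = o then S else 0)
        = (∑ j, K i j * x j - S * K i o) * (x i - if i = o then S else 0) := by
      have h4 (c : ℝ) : ∑ j, K i j * c * (x j - if j = o then S else 0)
          = ∑ j, K i j * x j * c - S * K i o * c := by
        simp only [mul_sub, Finset.sum_sub_distrib, mul_ite, mul_zero, Finset.sum_ite_eq',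
          Finset.mem_univ, if_true]
        exact congrArg₂ _ (Finset.sum_congr rfl fun j _ => by ring) (by ring)
      rw [h4, sub_mul (∑ j, K i j * x j), Finset.sum_mul Finset.univ (fun j => K i j * x j)]
    simp only [h3]
    simp only [mul_sub, mul_ite, mul_zero, Finset.sum_sub_distrib, Finset.sum_ite_eq',
      Finset.mem_univ, if_true, sub_mul, Finset.sum_mul]
    have h4 : ∑ i, ∑ j, K i j * x j * x i = ∑ i, ∑ j, K i j * x i * x j :=
      Finset.sum_congr rfl fun i _ => Finset.sum_congr rfl fun j _ => by ring
    have h5 : ∑ i, S * K i o * x i = S * ∑ i, K i o * x i := by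
      simp [Finset.mul_sum, mul_assoc]
    rw [h4, h5, ← Finset.sum_mul, h2]
    ring
  have h6 : ∑ i, ∑ j, (K i o + K j o - K i j - K o o) * x i * x j
      = 2 * S * ∑ i, K i o * x i - ∑ i, ∑ j, K i j * x i * x j - S ^ 2 * K o o := by
    have h7 : ∑ i, ∑ j, K i o * x i * x j = S * ∑ i, K i o * x i := by
      rw [← Finset.sum_mul_sum, mul_comm]
    have h8 : ∑ i, ∑ j, x i * (K j o * x j) = S * ∑ i, K i o * x i := by
      rw [← Finset.sum_mul_sum]
    have h9 : ∑ i, ∑ j, K o o * x i * x j = S ^ 2 * K o o := by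
      rw [← Finset.sum_mul_sum, ← Finset.mul_sum]
      ring
    have h10 (i j : ι) : (K i o + K j o - K i j - K o o) * x i * x j
        = K i o * x i * x j + x i * (K j o * x j) - K i j * x i * x j - K o o * x i * x j := by
      ring
    simp only [h10, Finset.sum_sub_distrib, Finset.sum_add_distrib, h7, h8, h9]
    ring
  simp only [Matrix.of_apply]
  linarith

/-- One direction of **Schoenberg's theorem**: `exp (-K)` is positive semidefinite if `K` is
conditionally negative semidefinite. -/
theorem sum_exp_neg_nonneg_of_condNeg (hsymm : ∀ i j, K i j = K j i)
    (hneg : ∀ ξ : ι → ℝ, ∑ i, ξ i = 0 → ∑ i, ∑ j, K i j * ξ i * ξ j ≤ 0) (ξ : ι → ℝ) :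
    0 ≤ ∑ i, ∑ j, Real.exp (-K i j) * ξ i * ξ j := by
  rcases isEmpty_or_nonempty ι with hι | ⟨⟨o⟩⟩
  · simp
  have h := (Matrix.posSemidef_iff_sum_nonneg.1 (posSemidef_of_condNeg hsymm hneg o).map_exp_s12).2
    fun i => Real.exp (-K i o) * ξ i
  have h2 : ∑ i, ∑ j, Real.exp (-K i j) * ξ i * ξ j
      = Real.exp (K o o) * ∑ i, ∑ j, Real.exp (K i o + K j o - K i j - K o o)
        * (Real.exp (-K i o) * ξ i) * (Real.exp (-K j o) * ξ j) := by
    simp only [Finset.mul_sum]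
    refine Finset.sum_congr rfl fun i _ => Finset.sum_congr rfl fun j _ => ?_
    have h3 : Real.exp (-K i j) = Real.exp (K o o) * Real.exp (K i o + K j o - K i j - K o o)
        * Real.exp (-K i o) * Real.exp (-K j o) := by
      rw [← Real.exp_add, ← Real.exp_add, ← Real.exp_add]
      ring_nf
    rw [h3]
    ring
  rw [h2]
  exact mul_nonneg (Real.exp_pos _).le h

/-- The resolvent-type kernel `(t + K)⁻¹` is positive semidefinite if `K ≥ 0` is conditionally
negative semidefinite and `t > 0`. -/
theorem sum_inv_add_nonneg_of_condNeg (hsymm : ∀ i j, K i j = K j i) (hK : ∀ i j, 0 ≤ K i j)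
    (hneg : ∀ ξ : ι → ℝ, ∑ i, ξ i = 0 → ∑ i, ∑ j, K i j * ξ i * ξ j ≤ 0) (ξ : ι → ℝ)
    {t : ℝ} (ht : 0 < t) :
    0 ≤ ∑ i, ∑ j, (t + K i j)⁻¹ * ξ i * ξ j := by
  have hlt (i j : ι) : -(t + K i j) < 0 := by linarith [hK i j]
  have hint (i j : ι) : MeasureTheory.IntegrableOn
      (fun s => Real.exp (-(t + K i j) * s) * ξ i * ξ j) (Set.Ioi 0) :=
    ((integrableOn_exp_mul_Ioi (hlt i j) 0).mul_const _).mul_const _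
  have heq : ∑ i, ∑ j, (t + K i j)⁻¹ * ξ i * ξ j
      = ∫ s in Set.Ioi (0 : ℝ), ∑ i, ∑ j, Real.exp (-(t + K i j) * s) * ξ i * ξ j := by
    rw [MeasureTheory.integral_finsetSum _
      fun i _ => MeasureTheory.integrable_finsetSum _ fun j _ => hint i j]
    refine Finset.sum_congr rfl fun i _ => ?_
    rw [MeasureTheory.integral_finsetSum _ fun j _ => hint i j]
    refine Finset.sum_congr rfl fun j _ => ?_
    rw [MeasureTheory.integral_mul_const, MeasureTheory.integral_mul_const,
      integral_exp_mul_Ioi (hlt i j)]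
    rw [mul_zero, Real.exp_zero, neg_div_neg_eq, one_div]
  rw [heq]
  refine MeasureTheory.setIntegral_nonneg measurableSet_Ioi fun s hs => ?_
  have hs : 0 < s := hs
  have h := sum_exp_neg_nonneg_of_condNeg (K := fun i j => s * (t + K i j))
    (fun i j => by rw [hsymm i j]) (fun η hη => ?_) ξ
  · simpa only [neg_mul, mul_comm s] using h
  · have h2 : ∑ i, ∑ j, s * (t + K i j) * η i * η j
        = s * (t * ((∑ i, η i) * ∑ j, η j) + ∑ i, ∑ j, K i j * η i * η j) := by
      rw [Finset.sum_mul_sum]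
      simp only [Finset.mul_sum, ← Finset.sum_add_distrib]
      exact Finset.sum_congr rfl fun i _ => Finset.sum_congr rfl fun j _ => by ring
    rw [h2, hη, mul_zero, mul_zero, zero_add]
    exact mul_nonpos_of_nonneg_of_nonpos hs.le (hneg η hη)

/-- Powers with exponent in `(0, 1)` of a nonnegative conditionally negative semidefinite kernel
are conditionally negative semidefinite. -/
theorem sum_rpow_nonpos_of_condNeg (hsymm : ∀ i j, K i j = K j i) (hK : ∀ i j, 0 ≤ K i j)
    (hneg : ∀ ξ : ι → ℝ, ∑ i, ξ i = 0 → ∑ i, ∑ j, K i j * ξ i * ξ j ≤ 0)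
    {r : ℝ} (hr : r ∈ Set.Ioo (0 : ℝ) 1) (ξ : ι → ℝ) (hξ : ∑ i, ξ i = 0) :
    ∑ i, ∑ j, K i j ^ r * ξ i * ξ j ≤ 0 := by
  obtain ⟨μ, hμ⟩ := Real.exists_measure_rpow_eq_integral_rpowIntegrand₀₁ hr
  have hint (i j : ι) : MeasureTheory.IntegrableOn
      (fun t => Real.rpowIntegrand₀₁ r t (K i j) * ξ i * ξ j) (Set.Ioi 0) μ :=
    ((hμ _ (hK i j)).1.mul_const _).mul_const _
  have heq : ∑ i, ∑ j, K i j ^ r * ξ i * ξ j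
      = ∫ t in Set.Ioi (0 : ℝ), ∑ i, ∑ j, Real.rpowIntegrand₀₁ r t (K i j) * ξ i * ξ j ∂μ := by
    rw [MeasureTheory.integral_finsetSum _
      fun i _ => MeasureTheory.integrable_finsetSum _ fun j _ => hint i j]
    refine Finset.sum_congr rfl fun i _ => ?_
    rw [MeasureTheory.integral_finsetSum _ fun j _ => hint i j]
    refine Finset.sum_congr rfl fun j _ => ?_
    rw [MeasureTheory.integral_mul_const, MeasureTheory.integral_mul_const, ← (hμ _ (hK i j)).2]
  rw [heq]
  refine MeasureTheory.setIntegral_nonpos measurableSet_Ioi fun t ht => ?_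
  have ht : 0 < t := ht
  have h : ∑ i, ∑ j, Real.rpowIntegrand₀₁ r t (K i j) * ξ i * ξ j
      = t ^ r * (t⁻¹ * ((∑ i, ξ i) * ∑ j, ξ j) - ∑ i, ∑ j, (t + K i j)⁻¹ * ξ i * ξ j) := by
    rw [Finset.sum_mul_sum]
    simp only [Finset.mul_sum, ← Finset.sum_sub_distrib, Real.rpowIntegrand₀₁]
    exact Finset.sum_congr rfl fun i _ => Finset.sum_congr rfl fun j _ => by ring
  rw [h, hξ, mul_zero, mul_zero, zero_sub]
  exact mul_nonpos_of_nonneg_of_nonpos (Real.rpow_nonneg ht.le _)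
    (neg_nonpos.2 (sum_inv_add_nonneg_of_condNeg hsymm hK hneg ξ ht))

end ConditionallyNegative

/-- The set of `p ≥ 0` for which a metric space has `p`-negative type is an interval
containing `0`: if `(X, d)` has `p`-negative type and `0 ≤ q ≤ p`, then `(X, d)` has
`q`-negative type. -/
theorem negType_interval (X : Type*) [MetricSpace X] (p q : ℝ)
    (hp : IsNegType X p) (hq0 : 0 ≤ q) (hqp : q ≤ p) : IsNegType X q := by
  intro N x ξ hξ
  rcases hq0.eq_or_lt with rfl | hq
  · simp [← Finset.mul_sum, hξ]
  rcases hqp.eq_or_lt with rfl | hlt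
  · exact hp N x ξ hξ
  have hp0 : 0 < p := hq.trans hlt
  have h := sum_rpow_nonpos_of_condNeg (K := fun i j => dist (x i) (x j) ^ p)
    (fun i j => by rw [dist_comm]) (fun i j => by positivity) (hp N x)
    (r := q / p) ⟨by positivity, (div_lt_one hp0).2 hlt⟩ ξ hξ
  simpa only [← Real.rpow_mul dist_nonneg, mul_div_cancel₀ q hp0.ne'] using h
end

section
/- (Schoenberg's embedding theorem, finite case) A finite metric space (X,d) embeds isometrically into a real Hilbert space (equivalently, into some Euclidean space ℝ^m with the Euclidean metric) if and only if (X,d) has 2-negative type. -/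
open BigOperators

/-- A real positive semidefinite matrix is the Gram matrix of vectors in a Euclidean space. -/
theorem Matrix.PosSemidef.exists_gram_eq {n : Type*} [Finite n] {M : Matrix n n ℝ}
    (hM : M.PosSemidef) :
    ∃ (m : ℕ) (v : n → EuclideanSpace ℝ (Fin m)), Matrix.gram ℝ v = M := by
  obtain ⟨m, u, rfl⟩ := Matrix.posSemidef_iff_eq_sum_vecMulVec.mp hM
  refine ⟨m, fun a ↦ WithLp.toLp 2 fun i ↦ u i a, ?_⟩
  ext a b
  simp [Matrix.gram_apply, PiLp.inner_apply, Matrix.sum_apply, Matrix.vecMulVec_apply, mul_comm]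

/-- The matrix of Gromov-type products `(d(a,o)² + d(b,o)² - d(a,b)²) / 2` based at `o`. -/
noncomputable def sqDistProduct {X : Type*} [MetricSpace X] (o : X) : Matrix X X ℝ :=
  Matrix.of fun a b ↦ (dist a o ^ 2 + dist b o ^ 2 - dist a b ^ 2) / 2

theorem sqDistProduct_apply {X : Type*} [MetricSpace X] (o a b : X) :
    sqDistProduct o a b = (dist a o ^ 2 + dist b o ^ 2 - dist a b ^ 2) / 2 := rfl

/-- In a real inner product space, the quadratic form of the squared distances is nonpositive on
weights of total mass zero. -/
theorem sum_sq_dist_mul_nonpos {ι E : Type*} [Fintype ι] [NormedAddCommGroup E]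
    [InnerProductSpace ℝ E] (v : ι → E) (ξ : ι → ℝ) (hξ : ∑ i, ξ i = 0) :
    ∑ i, ∑ j, dist (v i) (v j) ^ 2 * ξ i * ξ j ≤ 0 := by
  have key := inner_sum_smul_sum_smul_of_sum_eq_zero v hξ v hξ
  have hnonneg := real_inner_self_nonneg (x := ∑ i, ξ i • v i)
  have hsum : ∑ i, ∑ j, dist (v i) (v j) ^ 2 * ξ i * ξ j =
      ∑ i, ∑ j, ξ i * ξ j * (‖v i - v j‖ * ‖v i - v j‖) :=
    Finset.sum_congr rfl fun i _ ↦ Finset.sum_congr rfl fun j _ ↦ by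
      rw [dist_eq_norm]; ring
  linarith

theorem IsNegType.sum_sq_dist_nonpos {X ι : Type*} [MetricSpace X] [Fintype ι]
    (h : IsNegType X 2) (x : ι → X) (ξ : ι → ℝ) (hξ : ∑ i, ξ i = 0) :
    ∑ i, ∑ j, dist (x i) (x j) ^ 2 * ξ i * ξ j ≤ 0 := by
  let e := (Fintype.equivFin ι).symm
  have hneg := h _ (x ∘ e) (ξ ∘ e) ((e.sum_comp ξ).trans hξ)
  simp only [Real.rpow_two, Function.comp_apply] at hneg
  rw [← e.sum_comp]
  simpa only [← e.sum_comp fun j ↦ dist (x (e _)) (x j) ^ 2 * ξ (e _) * ξ j] using hneg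

open scoped Matrix in
theorem IsNegType.posSemidef_sqDistProduct {X : Type*} [MetricSpace X] [Finite X]
    (h : IsNegType X 2) (o : X) : (sqDistProduct o).PosSemidef := by
  have := Fintype.ofFinite X
  refine .of_dotProduct_mulVec_nonneg ?_ fun ξ ↦ ?_
  · ext a b
    simp [sqDistProduct_apply, dist_comm a b, add_comm]
  · have hneg := h.sum_sq_dist_nonpos (fun i : Option X ↦ i.getD o)
      (fun i ↦ i.elim (-∑ a, ξ a) ξ) (by simp [Fintype.sum_option])
    simp only [Fintype.sum_option, Option.getD_none, Option.getD_some, Option.elim_none,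
      Option.elim_some, dist_self, Finset.sum_add_distrib, dist_comm o] at hneg
    have hform : star ξ ⬝ᵥ sqDistProduct o *ᵥ ξ =
        (∑ a, ξ a) * (∑ a, dist a o ^ 2 * ξ a) - (∑ a, ∑ b, dist a b ^ 2 * ξ a * ξ b) / 2 := by
      have hleft : (∑ a, ξ a) * (∑ a, dist a o ^ 2 * ξ a) =
          ∑ a, ∑ b, ξ a * (dist b o ^ 2 * ξ b) := Finset.sum_mul_sum ..
      have hright : (∑ a, ξ a) * (∑ a, dist a o ^ 2 * ξ a) =
          ∑ a, ∑ b, dist a o ^ 2 * ξ a * ξ b := by rw [mul_comm]; exact Finset.sum_mul_sum ..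
      have hexpand : star ξ ⬝ᵥ sqDistProduct o *ᵥ ξ = ∑ a, ∑ b,
          (ξ a * (dist b o ^ 2 * ξ b) + dist a o ^ 2 * ξ a * ξ b
            - dist a b ^ 2 * ξ a * ξ b) / 2 := by
        simp only [dotProduct, Matrix.mulVec, Finset.mul_sum, sqDistProduct_apply, star_trivial]
        exact Finset.sum_congr rfl fun a _ ↦ Finset.sum_congr rfl fun b _ ↦ by ring
      simp only [hexpand, ← Finset.sum_div, Finset.sum_sub_distrib, Finset.sum_add_distrib,
        ← hleft, ← hright]
      ring
    have hcross (S : ℝ) : ∑ a, dist a o ^ 2 * (-S) * ξ a = -(S * ∑ a, dist a o ^ 2 * ξ a) := by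
      rw [Finset.mul_sum, ← Finset.sum_neg_distrib]
      exact Finset.sum_congr rfl fun a _ ↦ by ring
    have hcross' (S : ℝ) : ∑ a, dist a o ^ 2 * ξ a * (-S) = -(S * ∑ a, dist a o ^ 2 * ξ a) := by
      rw [← Finset.sum_mul]; ring
    rw [hcross, hcross'] at hneg
    rw [hform]
    linarith

/-- Vectors whose Gram matrix is the matrix of products based at `o` realize the metric. -/
theorem dist_eq_of_gram_eq_sqDistProduct {X E : Type*} [MetricSpace X] [NormedAddCommGroup E]
    [InnerProductSpace ℝ E] {o : X} {v : X → E} (hv : Matrix.gram ℝ v = sqDistProduct o)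
    (a b : X) : dist (v a) (v b) = dist a b := by
  have hinner (a b : X) : inner ℝ (v a) (v b) = sqDistProduct o a b := by
    rw [← hv, Matrix.gram_apply]
  rw [← sq_eq_sq₀ dist_nonneg dist_nonneg, dist_eq_norm, norm_sub_sq_real,
    ← real_inner_self_eq_norm_sq, ← real_inner_self_eq_norm_sq, hinner, hinner, hinner]
  simp only [sqDistProduct_apply, dist_self]
  ring

/-- Schoenberg's embedding theorem (finite case): a finite metric space embeds
isometrically into a Euclidean space `ℝ^m` (equivalently, into a real Hilbert space)
if and only if it has `2`-negative type. -/
theorem schoenberg_embedding (X : Type*) [MetricSpace X] [Finite X] :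
    (∃ (m : ℕ) (f : X → EuclideanSpace ℝ (Fin m)),
        ∀ a b : X, dist (f a) (f b) = dist a b) ↔
      IsNegType X 2 := by
  constructor
  · rintro ⟨m, f, hf⟩ N x ξ hξ
    simpa only [Function.comp_apply, hf, Real.rpow_two] using sum_sq_dist_mul_nonpos (f ∘ x) ξ hξ
  · intro h
    obtain _ | ⟨⟨o⟩⟩ := isEmpty_or_nonempty X
    · exact ⟨0, isEmptyElim, isEmptyElim⟩
    · obtain ⟨m, v, hv⟩ := (h.posSemidef_sqDistProduct o).exists_gram_eq
      exact ⟨m, v, dist_eq_of_gram_eq_sqDistProduct hv⟩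
end

section
/- Let X = {x_0,...,x_n} be a finite metric space and let G_2 be its Gramian at exponent p = 2. Then (X,d) embeds isometrically into (ℝ^m, ‖·‖_2) if and only if G_2 is positive semidefinite and has rank at most m. -/
open Matrix BigOperators

section GramMatrix

variable {ι E F : Type*} [Fintype ι]
  [NormedAddCommGroup E] [InnerProductSpace ℝ E] [FiniteDimensional ℝ E]
  [NormedAddCommGroup F] [InnerProductSpace ℝ F] [FiniteDimensional ℝ F]

/-- The rank of a Gram matrix is the dimension of the span of its vectors. -/
lemma rank_gram_eq_finrank_span (v : ι → E) :
    (Matrix.gram ℝ v).rank = Module.finrank ℝ (Submodule.span ℝ (Set.range v)) := by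
  let b := stdOrthonormalBasis ℝ E
  obtain ⟨e, he⟩ : ∃ e : E ≃ₗ[ℝ] (Fin (Module.finrank ℝ E) → ℝ), ∀ x i, b.repr x i = e x i :=
    ⟨b.repr.toLinearEquiv.trans (WithLp.linearEquiv 2 ℝ _), fun _ _ => rfl⟩
  have hspan : Submodule.span ℝ (Set.range (e ∘ v)) =
      (Submodule.span ℝ (Set.range v)).map e.toLinearMap := by
    rw [Submodule.map_span, Set.range_comp]
    rfl
  have hcols : (Matrix.of fun i j => b.repr (v j) i).col = e ∘ v := by
    ext j i
    exact he _ _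
  rw [Matrix.gram_eq_conjTranspose_mul b v, Matrix.rank_conjTranspose_mul_self,
    Matrix.rank_eq_finrank_span_cols, hcols, hspan]
  exact e.finrank_map_eq _

/-- Every positive semidefinite real matrix is the Gram matrix of a family of vectors. -/
lemma Matrix.PosSemidef.exists_eq_gram {A : Matrix ι ι ℝ} (hA : A.PosSemidef) :
    ∃ v : ι → EuclideanSpace ℝ ι, A = Matrix.gram ℝ v := by
  classical
  open scoped MatrixOrder Matrix.Norms.L2Operator in
  obtain ⟨B, rfl⟩ := CStarAlgebra.nonneg_iff_eq_star_mul_self.mp hA.nonneg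
  refine ⟨fun j => WithLp.toLp 2 (B.col j), ?_⟩
  ext i j
  simp [Matrix.mul_apply, Matrix.star_eq_conjTranspose, PiLp.inner_apply, mul_comm]

/-- There is a linear isometry between finite-dimensional real inner product spaces whenever the
dimension does not decrease. -/
lemma exists_linearIsometry_of_finrank_le (h : Module.finrank ℝ E ≤ Module.finrank ℝ F) :
    Nonempty (E →ₗᵢ[ℝ] F) := by
  let b := stdOrthonormalBasis ℝ E
  let c := stdOrthonormalBasis ℝ F
  let f : E →ₗ[ℝ] F := b.toBasis.constr ℝ (c ∘ Fin.castLE h)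
  have hb : Orthonormal ℝ b.toBasis := by simp
  refine ⟨f.isometryOfOrthonormal hb ?_⟩
  have hf : f ∘ b.toBasis = c ∘ Fin.castLE h :=
    funext fun i => b.toBasis.constr_basis ℝ _ i
  rw [hf]
  exact c.orthonormal.comp _ (Fin.castLE_injective h)

/-- A real matrix is the Gram matrix of vectors in `ℝ^m` if and only if it is positive
semidefinite of rank at most `m`. -/
lemma exists_gram_eq_iff_posSemidef_and_rank_le (A : Matrix ι ι ℝ) (m : ℕ) :
    (∃ v : ι → EuclideanSpace ℝ (Fin m), A = Matrix.gram ℝ v) ↔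
      A.PosSemidef ∧ A.rank ≤ m := by
  constructor
  · rintro ⟨v, rfl⟩
    refine ⟨Matrix.posSemidef_gram ℝ v, ?_⟩
    rw [rank_gram_eq_finrank_span]
    exact (Submodule.finrank_le _).trans_eq finrank_euclideanSpace_fin
  · rintro ⟨hA, hr⟩
    obtain ⟨v, rfl⟩ := hA.exists_eq_gram
    rw [rank_gram_eq_finrank_span] at hr
    obtain ⟨g⟩ := exists_linearIsometry_of_finrank_le
      (E := Submodule.span ℝ (Set.range v)) (F := EuclideanSpace ℝ (Fin m)) (by simpa using hr)
    refine ⟨fun i => g ⟨v i, Submodule.subset_span ⟨i, rfl⟩⟩, ?_⟩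
    ext i j
    simp

end GramMatrix

/-- A finite metric space `X = {x_0, …, x_n}` embeds isometrically into
`(ℝ^m, ‖·‖₂)` if and only if its Gramian `G_2` at exponent `p = 2` is positive
semidefinite of rank at most `m`. -/
theorem isometric_embedding_iff_gramian (n m : ℕ) [MetricSpace (Fin (n + 1))] :
    (∃ f : Fin (n + 1) → EuclideanSpace ℝ (Fin m),
        ∀ i j : Fin (n + 1), dist (f i) (f j) = dist i j) ↔
      (Gram n 2).PosSemidef ∧ (Gram n 2).rank ≤ m := by
  rw [← exists_gram_eq_iff_posSemidef_and_rank_le]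
  constructor
  · rintro ⟨f, hf⟩
    refine ⟨fun i => f i.succ - f 0, ?_⟩
    ext i j
    rw [Matrix.gram_apply, real_inner_eq_norm_mul_self_add_norm_mul_self_sub_norm_sub_mul_self_div_two,
      sub_sub_sub_cancel_right, ← dist_eq_norm, ← dist_eq_norm, ← dist_eq_norm, hf, hf, hf]
    simp [Gram, sq]
  · rintro ⟨v, hv⟩
    have hG (i j : Fin n) : (dist i.succ 0 ^ 2 + dist j.succ 0 ^ 2 - dist i.succ j.succ ^ 2) / 2 =
        inner ℝ (v i) (v j) := by
      simpa [Gram] using congrFun₂ hv i j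
    have hnorm (i : Fin n) : ‖v i‖ = dist i.succ 0 := by
      rw [← sq_eq_sq₀ (norm_nonneg _) dist_nonneg, ← real_inner_self_eq_norm_sq, ← hG, dist_self]
      ring
    refine ⟨Fin.cons 0 v, fun i j => ?_⟩
    cases i using Fin.cases with
    | zero =>
      cases j using Fin.cases with
      | zero => simp
      | succ j => simpa [dist_comm (0 : Fin (n + 1))] using hnorm j
    | succ i =>
      cases j using Fin.cases with
      | zero => simpa using hnorm i
      | succ j =>
        rw [Fin.cons_succ, Fin.cons_succ, ← sq_eq_sq₀ dist_nonneg dist_nonneg, dist_eq_norm,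
          norm_sub_sq_real, hnorm, hnorm, ← hG]
        ring
end
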